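/- arXiv:math/0007008 — 2 statements merged into one kernel-verified Lean document; each statement's English description precedes it below -/
import Mathlib

section
/- Let f be an entire function of the Krein class whose exponential type limsup_{|z|→∞} log|f(z)|/|z| is strictly positive, with zeros (λ_n), and let M ≥ 0 be a constant. Set δ_n = 1/((1 + |λ_n|^M)|f'(λ_n)|) and E = ⋃_n [λ_n − δ_n, λ_n + δ_n]. Then E is an Akhiezer–Levin set in the following sense: there exist a function u : ℂ → ℝ, continuous on ℂ, equal to 0 on E, positive and harmonic on ℂ∖E, symmetric (u(conj z) = u(z) for all z), satisfying u(z) ≤ A(1+|z|) for some constant A, and a constant κ > 0 such that u(z) ≥ κ|Im z| for all z ∈ ℂ. -/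
open Complex Filter Set

/-- `h` is harmonic on `U`: real-valued, `C²` on `U`, with vanishing Laplacian. -/
def HarmonicOn (h : ℂ → ℝ) (U : Set ℂ) : Prop :=
  ContDiffOn ℝ 2 h U ∧ ∀ z ∈ U,
    iteratedFDerivWithin ℝ 2 h U z ![1, 1] +
      iteratedFDerivWithin ℝ 2 h U z ![Complex.I, Complex.I] = 0

/-- The subset of `ℂ` corresponding to a subset of `ℝ`. -/
def cplx (E : Set ℝ) : Set ℂ := (fun x : ℝ => (x : ℂ)) '' E

/-- `f` is an entire function of the Krein class, with (real, simple) zeros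
enumerated by the sequence `lam`. -/
def KreinClass (f : ℂ → ℂ) (lam : ℕ → ℝ) : Prop :=
  Differentiable ℂ f ∧
  Function.Injective lam ∧
  (∀ z : ℂ, f z = 0 ↔ ∃ n, z = (lam n : ℂ)) ∧
  (∀ n, deriv f (lam n) ≠ 0) ∧
  Summable (fun n => 1 / ‖deriv f (lam n)‖) ∧
  ∀ z : ℂ, f z ≠ 0 →
    Summable (fun n => ‖1 / (deriv f (lam n) * (z - (lam n : ℂ)))‖) ∧
    1 / f z = ∑' n, 1 / (deriv f (lam n) * (z - (lam n : ℂ)))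

section Part1
open Complex Filter Set

def SubMeanAt (φ : ℂ → ℝ) (z : ℂ) : Prop :=
  ∃ r0 > 0, ∀ r, 0 < r → r < r0 → φ z ≤ Real.circleAverage φ z r

lemma circleAverage_lt_aux {φ : ℂ → ℝ} {z w0 : ℂ} {r M : ℝ} (hr : 0 < r)
    (hc : ContinuousOn φ (Metric.sphere z r))
    (hle : ∀ w ∈ Metric.sphere z r, φ w ≤ M) (hw0 : w0 ∈ Metric.sphere z r) (hlt : φ w0 < M) :
    Real.circleAverage φ z r < M := by
  have h2 : (0:ℝ) < 2 * Real.pi := by positivity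
  have hmem : ∀ θ, circleMap z r θ ∈ Metric.sphere z r := fun θ => circleMap_mem_sphere z hr.le θ
  obtain ⟨θ, hθ, hθw⟩ : ∃ θ ∈ Ioc 0 (2 * Real.pi), circleMap z r θ = w0 := by
    have := image_circleMap_Ioc z r
    rw [abs_of_pos hr] at this
    rw [← this] at hw0
    exact hw0
  have hcont : Continuous fun θ => φ (circleMap z r θ) :=
    hc.comp_continuous (continuous_circleMap z r) hmem
  have : ∫ θ in (0:ℝ)..(2 * Real.pi), φ (circleMap z r θ) < ∫ θ in (0:ℝ)..(2 * Real.pi), M := by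
    apply intervalIntegral.integral_lt_integral_of_continuousOn_of_le_of_exists_lt h2
      hcont.continuousOn continuousOn_const
    · intro x _; exact hle _ (hmem x)
    · exact ⟨θ, Ioc_subset_Icc_self hθ, by rw [hθw]; exact hlt⟩
  rw [Real.circleAverage, smul_eq_mul]
  simp only [intervalIntegral.integral_const, sub_zero, smul_eq_mul] at this
  calc _ < (2 * Real.pi)⁻¹ * (2 * Real.pi * M) := by gcongr
    _ = M := by field_simp

lemma max_principle {K : Set ℂ} (hK : IsCompact K) {φ : ℂ → ℝ} (hc : ContinuousOn φ K)
    (h : ∀ z ∈ K, 0 < φ z → z ∈ interior K ∧ SubMeanAt φ z) : ∀ z ∈ K, φ z ≤ 0 := by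
  by_contra! hcon
  obtain ⟨z0, hz0, hz0p⟩ := hcon
  obtain ⟨z1, hz1, hmax⟩ := hK.exists_isMaxOn ⟨z0, hz0⟩ hc
  have hM : 0 < φ z1 := hz0p.trans_le (hmax hz0)
  have hK1 : IsCompact (K ∩ φ ⁻¹' {φ z1}) :=
    hK.of_isClosed_subset (hc.preimage_isClosed_of_isClosed hK.isClosed isClosed_singleton)
      inter_subset_left
  obtain ⟨z2, hz2, hre⟩ := hK1.exists_isMaxOn ⟨z1, hz1, rfl⟩ Complex.continuous_re.continuousOn
  have hz2v : φ z2 = φ z1 := hz2.2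
  obtain ⟨hint, r0, hr0, hsub⟩ := h z2 hz2.1 (hz2v ▸ hM)
  obtain ⟨e, he, heK⟩ := Metric.mem_nhds_iff.1 (mem_interior_iff_mem_nhds.1 hint)
  set r := min (r0 / 2) (e / 2) with hr
  have hrpos : 0 < r := by positivity
  have hr1 : r < r0 := (min_le_left _ _).trans_lt (by linarith)
  have hr2 : r < e := (min_le_right _ _).trans_lt (by linarith)
  have hsK : Metric.sphere z2 r ⊆ K := fun w hw => heK (by
    rw [Metric.mem_ball, Metric.mem_sphere.1 hw]; exact hr2)
  have hw : z2 + r ∈ Metric.sphere z2 r := by simp [abs_of_pos hrpos]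
  have h1 := hsub r hrpos hr1
  have h2 := circleAverage_lt_aux (M := φ z1) hrpos (hc.mono hsK) (fun w hw => hmax (hsK hw)) hw
    (lt_of_le_of_ne (hmax (hsK hw)) (fun heq => by
      have := hre (show z2 + r ∈ K ∩ φ ⁻¹' {φ z1} from ⟨hsK hw, heq⟩)
      simp at this; linarith))
  linarith

lemma SubMeanAt.sub_harmonic {φ h : ℂ → ℝ} {z : ℂ} {U : Set ℂ} (hU : U ∈ nhds z)
    (hφ : SubMeanAt φ z) (hc : ContinuousOn φ U)
    (hh : InnerProductSpace.HarmonicAt h z) : SubMeanAt (fun w => φ w - h w) z := by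
  obtain ⟨r0, hr0, hs⟩ := hφ
  obtain ⟨e, he, hee⟩ := Metric.mem_nhds_iff.1 (Filter.inter_mem hh.eventually hU)
  refine ⟨min r0 e, by positivity, fun r hr hr' => ?_⟩
  have hb : Metric.closedBall z |r| ⊆ Metric.ball z e := by
    rw [abs_of_pos hr]
    exact Metric.closedBall_subset_ball (hr'.trans_le (min_le_right _ _))
  have hH : InnerProductSpace.HarmonicOnNhd h (Metric.closedBall z |r|) :=
    fun w hw => (hee (hb hw)).1
  have hsp : Metric.sphere z |r| ⊆ Metric.closedBall z |r| := Metric.sphere_subset_closedBall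
  rw [Real.circleAverage_fun_sub, hH.circleAverage_eq]
  · have := hs r hr (hr'.trans_le (min_le_left _ _)); linarith
  · exact (hc.mono fun w hw => (hee (hb (hsp hw))).2).circleIntegrable'
  · exact (hH.continuousOn.mono hsp).circleIntegrable'

lemma subMeanAt_of_harmonicAt {h : ℂ → ℝ} {z : ℂ} (hh : InnerProductSpace.HarmonicAt h z) :
    SubMeanAt h z := by
  obtain ⟨e, he, hee⟩ := Metric.mem_nhds_iff.1 hh.eventually
  refine ⟨e, he, fun r hr hr' => ?_⟩
  rw [InnerProductSpace.HarmonicOnNhd.circleAverage_eq]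
  intro w hw
  rw [abs_of_pos hr] at hw
  exact hee (Metric.closedBall_subset_ball hr' hw)

end Part1

section Part2
open Complex Filter Set Metric InnerProductSpace

/-- Poisson integral -/
noncomputable def PI (c : ℂ) (R : ℝ) (v : ℂ → ℝ) (w : ℂ) : ℝ :=
  Real.circleAverage (poissonKernel c w • v) c R

lemma poissonKernel_nonneg_aux {c w z : ℂ} {R : ℝ} (hw : w ∈ ball c R) (hz : z ∈ sphere c R) :
    0 ≤ poissonKernel c w z := by
  rw [poissonKernel_def]
  apply div_nonneg _ (by positivity)
  have h1 : ‖w - c‖ < R := by simpa [dist_eq_norm] using hw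
  have h2 : ‖z - c‖ = R := by simpa [dist_eq_norm] using hz
  rw [h2]
  nlinarith [norm_nonneg (w - c)]

lemma poissonKernel_cont_aux {c w : ℂ} {R : ℝ} (hw : w ∈ ball c R) :
    ContinuousOn (poissonKernel c w) (sphere c |R|) := by
  have : poissonKernel c w = fun z => (‖z - c‖ ^ 2 - ‖w - c‖ ^ 2) / ‖(z - c) - (w - c)‖ ^ 2 := rfl
  rw [this]
  apply ContinuousOn.div (by fun_prop) (by fun_prop)
  intro z hz h
  have h3 : z - c - (w - c) = 0 := by simpa using h
  have : z = w := by linear_combination h3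
  rw [this] at hz
  have := mem_ball.1 hw
  have := mem_sphere.1 hz
  have := le_abs_self R
  linarith

lemma PI_integrable {c w : ℂ} {R : ℝ} (hw : w ∈ ball c R) {v : ℂ → ℝ}
    (hv : CircleIntegrable v c R) : CircleIntegrable (poissonKernel c w • v) c R :=
  hv.continuousOn_smul (poissonKernel_cont_aux hw)

lemma PI_mono {c w : ℂ} {R : ℝ} (hw : w ∈ ball c R) {v1 v2 : ℂ → ℝ}
    (h1 : CircleIntegrable v1 c R) (h2 : CircleIntegrable v2 c R)
    (h : ∀ z ∈ sphere c R, v1 z ≤ v2 z) : PI c R v1 w ≤ PI c R v2 w := by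
  have hR : 0 < R := pos_of_mem_ball hw
  apply Real.circleAverage_mono (PI_integrable hw h1) (PI_integrable hw h2)
  intro z hz
  rw [abs_of_pos hR] at hz
  exact mul_le_mul_of_nonneg_left (h z hz) (poissonKernel_nonneg_aux hw hz)

lemma PI_harm {c w : ℂ} {R : ℝ} (hw : w ∈ ball c R) {v : ℂ → ℝ}
    (h : HarmonicOnNhd v (closedBall c R)) : PI c R v w = v w :=
  h.circleAverage_poissonKernel_smul hw

lemma PI_re {c : ℂ} {R : ℝ} (hR : 0 < R) {v : ℂ → ℝ} (hv : CircleIntegrable v c R) :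
    ∃ F : ℂ → ℂ, AnalyticOnNhd ℂ F (ball c R) ∧ ∀ w ∈ ball c R, PI c R v w = (F w).re := by
  have hv' : CircleIntegrable (fun ζ => (v ζ : ℂ)) c R := by
    simp only [CircleIntegrable, intervalIntegrable_iff] at hv ⊢
    exact Complex.ofRealCLM.integrable_comp hv
  refine ⟨fun w => 2 * ((2 * Real.pi * I : ℂ)⁻¹ • ∮ z in C(c, R), (z - w)⁻¹ • (v z : ℂ)) -
    Real.circleAverage (fun ζ => (v ζ : ℂ)) c R, ?_, ?_⟩
  · have h := (hasFPowerSeriesOn_cauchy_integral (R := ⟨R, hR.le⟩) hv' hR).analyticOnNhd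
    have h2 : AnalyticOnNhd ℂ (fun w => ((2 * Real.pi * I : ℂ)⁻¹ • ∮ z in C(c, R), (z - w)⁻¹ • (v z : ℂ)))
      (ball c R) := by
      intro w hw
      exact h w (by rw [Metric.mem_eball, edist_dist]; exact (ENNReal.ofReal_lt_coe_iff (by simp)).2 hw)
    intro w hw
    exact (analyticAt_const.mul (h2 w hw)).sub analyticAt_const
  · intro w hw
    have hcont := continuousOn_herglotzRieszKernel_sphere hw
    have hi : CircleIntegrable (fun ζ ↦ herglotzRieszKernel c w ζ • (v ζ : ℂ)) c R :=
      hv'.continuousOn_smul hcont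
    have hne : ∀ z ∈ sphere c |R|, z - w ≠ 0 := by
      intro z hz h
      rw [sub_eq_zero.1 h, abs_of_pos hR] at hz
      have := mem_ball.1 hw
      have := mem_sphere.1 hz
      linarith
    have hcc : ContinuousOn (fun ζ : ℂ => (2 * (ζ - c)) / (ζ - w)) (sphere c |R|) :=
      ContinuousOn.div (by fun_prop) (by fun_prop) hne
    have hi2 : CircleIntegrable (fun ζ ↦ ((2 * (ζ - c)) / (ζ - w)) • (v ζ : ℂ)) c R :=
      hv'.continuousOn_smul hcc
    have e1 : PI c R v w = (Real.circleAverage (fun ζ ↦ herglotzRieszKernel c w ζ • (v ζ : ℂ)) c R).re := by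
      have := (Complex.reCLM.circleAverage_comp_comm hi)
      simp only [Complex.reCLM_apply] at this
      rw [← this, PI, poissonKernel_eq_re_herglotzRieszKernel]
      congr 1
      ext ζ
      simp [Complex.mul_re]
    rw [e1]
    congr 1
    have e2 : Real.circleAverage (fun ζ ↦ herglotzRieszKernel c w ζ • (v ζ : ℂ)) c R =
      Real.circleAverage (fun ζ ↦ ((2 * (ζ - c)) / (ζ - w)) • (v ζ : ℂ) - (v ζ : ℂ)) c R := by
      apply Real.circleAverage_congr_sphere
      intro z hz
      have := hne z hz
      have h3 : z - c - (w - c) ≠ 0 := by convert this using 1; ring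
      simp only [herglotzRieszKernel_def, smul_eq_mul]
      field_simp
      ring
    rw [e2, Real.circleAverage_fun_sub hi2 hv']
    congr 1
    have e3 : (∮ z in C(c, R), (z - c)⁻¹ • ((2 * (z - c)) / (z - w)) • (v z : ℂ)) =
        2 * ∮ z in C(c, R), (z - w)⁻¹ • (v z : ℂ) := by
      rw [← smul_eq_mul (2:ℂ), ← circleIntegral.integral_smul]
      apply circleIntegral.integral_congr hR.le
      intro z hz
      have h1 := hne z (by rwa [abs_of_pos hR])
      have h2 : z - c ≠ 0 := by
        intro h
        rw [sub_eq_zero.1 h] at hz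
        have := mem_sphere.1 hz
        simp at this
        linarith
      simp only [smul_eq_mul]
      field_simp
    rw [Real.circleAverage_eq_circleIntegral hR.ne', e3]
    simp only [smul_eq_mul]
    ring

lemma PI_tendsto {c ζ0 : ℂ} {R : ℝ} {v : ℂ → ℝ} (hv : Continuous v)
    (hζ : ζ0 ∈ sphere c R) : Tendsto (PI c R v) (nhdsWithin ζ0 (ball c R)) (nhds (v ζ0)) := by
  set h : ℂ → ℝ := fun w => 2 * R ^ 2 - 2 * ((w - c) * (starRingEnd ℂ) (ζ0 - c)).re with hh
  have hharm : ∀ a b : ℝ, HarmonicOnNhd (fun w => a + b * h w) (closedBall c R) := by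
    intro a b w _
    have : (fun w => a + b * h w) = fun w =>
        ((a : ℂ) + b * (2 * R ^ 2 - 2 * ((w - c) * (starRingEnd ℂ) (ζ0 - c)))).re := by
      ext w
      simp only [hh, add_re, ofReal_re, re_ofReal_mul, sub_re]
      have e1 : ((2:ℂ) * R ^ 2).re = 2 * R ^ 2 := by exact_mod_cast ofReal_re _
      have e2 : ∀ x : ℂ, (2 * x).re = 2 * x.re := fun x => by simp
      rw [e1, e2]
    rw [this]
    apply AnalyticAt.harmonicAt_re
    fun_prop
  have hn : ‖ζ0 - c‖ = R := by simpa [dist_eq_norm] using hζ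
  have hsq : ∀ ζ ∈ sphere c R, h ζ = ‖ζ - ζ0‖ ^ 2 := by
    intro ζ hz
    have h1 : ‖ζ - c‖ = R := by simpa [dist_eq_norm] using hz
    have : ζ - ζ0 = (ζ - c) - (ζ0 - c) := by ring
    rw [this, ← normSq_eq_norm_sq, normSq_sub, normSq_eq_norm_sq, normSq_eq_norm_sq, h1, hn, hh]
    ring
  have h0 : h ζ0 = 0 := by rw [hsq ζ0 hζ]; simp
  have hcont : Continuous h := by
    simp only [hh]; fun_prop
  obtain ⟨M, hM⟩ := (isCompact_sphere c R).exists_bound_of_continuousOn hv.continuousOn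
  have hM0 : 0 ≤ M := (norm_nonneg _).trans (hM ζ0 hζ)
  rw [Metric.tendsto_nhdsWithin_nhds]
  intro ε hε
  obtain ⟨d, hd, hdd⟩ := Metric.continuous_iff.1 hv ζ0 (ε / 2) (by positivity)
  set K : ℝ := 2 * M / d ^ 2 with hK
  have hK0 : 0 ≤ K := by positivity
  obtain ⟨e, he, hee⟩ := Metric.continuous_iff.1 hcont ζ0 (ε / 2 / (K + 1)) (by positivity)
  have key : ∀ ζ ∈ sphere c R, |v ζ - v ζ0| ≤ ε / 2 + K * h ζ := by
    intro ζ hz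
    rw [hsq ζ hz]
    by_cases hc : dist ζ ζ0 < d
    · have := hdd ζ hc
      rw [Real.dist_eq] at this
      have : 0 ≤ K * ‖ζ - ζ0‖ ^ 2 := by positivity
      linarith
    · push Not at hc
      rw [dist_eq_norm] at hc
      have h1 : |v ζ - v ζ0| ≤ 2 * M := by
        have := hM ζ hz
        have h2 := hM ζ0 hζ
        rw [Real.norm_eq_abs] at this h2
        exact (abs_sub _ _).trans (by linarith)
      have : 2 * M ≤ K * ‖ζ - ζ0‖ ^ 2 := by
        calc 2 * M = K * d ^ 2 := by rw [hK]; field_simp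
          _ ≤ _ := by gcongr
      linarith
  refine ⟨e, he, fun w hw hwe => ?_⟩
  have hvi : CircleIntegrable v c R := hv.continuousOn.circleIntegrable'
  have hci : ∀ a b : ℝ, CircleIntegrable (fun w => a + b * h w) c R := fun a b =>
    (by fun_prop : Continuous (fun w => a + b * h w)).continuousOn.circleIntegrable'
  have u1 : PI c R v w ≤ (v ζ0 + ε / 2) + K * h w := by
    rw [← PI_harm hw (hharm _ _)]
    apply PI_mono hw hvi (hci _ _)
    intro z hz
    have := (abs_le.1 (key z hz)).2
    linarith
  have u2 : (v ζ0 - ε / 2) + (-K) * h w ≤ PI c R v w := by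
    rw [← PI_harm hw (hharm _ _)]
    apply PI_mono hw (hci _ _) hvi
    intro z hz
    have := (abs_le.1 (key z hz)).1
    linarith
  have u3 := hee w hwe
  rw [h0, Real.dist_eq, sub_zero, lt_div_iff₀ (by positivity)] at u3
  have u4 : |K * h w| < ε / 2 := by
    rw [abs_mul, abs_of_nonneg hK0]
    nlinarith [abs_nonneg (h w)]
  have := abs_lt.1 u4
  rw [Real.dist_eq, abs_lt]
  constructor <;> linarith

end Part2

section Part3
open Complex Filter Set Metric InnerProductSpace

open Classical in
noncomputable def TB (c : ℂ) (R : ℝ) (v : ℂ → ℝ) (z : ℂ) : ℝ :=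
  if z ∈ ball c R then PI c R v z else v z

lemma TB_in {c : ℂ} {R : ℝ} {v : ℂ → ℝ} {z : ℂ} (h : z ∈ ball c R) : TB c R v z = PI c R v z :=
  if_pos h
lemma TB_out {c : ℂ} {R : ℝ} {v : ℂ → ℝ} {z : ℂ} (h : z ∉ ball c R) : TB c R v z = v z :=
  if_neg h

lemma PI_harmonicAt {c z : ℂ} {R : ℝ} {v : ℂ → ℝ} (hv : CircleIntegrable v c R)
    (hz : z ∈ ball c R) : HarmonicAt (PI c R v) z := by
  obtain ⟨F, hF, hF2⟩ := PI_re (pos_of_mem_ball hz) hv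
  rw [harmonicAt_congr_nhds (f₂ := fun w => (F w).re)]
  · exact (hF z hz).harmonicAt_re
  · filter_upwards [isOpen_ball.mem_nhds hz] with w hw using hF2 w hw

lemma TB_harmonicAt {c z : ℂ} {R : ℝ} {v : ℂ → ℝ} (hv : CircleIntegrable v c R)
    (hz : z ∈ ball c R) : HarmonicAt (TB c R v) z := by
  rw [harmonicAt_congr_nhds (f₂ := PI c R v)]
  · exact PI_harmonicAt hv hz
  · filter_upwards [isOpen_ball.mem_nhds hz] with w hw using TB_in hw

lemma TB_continuous {c : ℂ} {R : ℝ} {v : ℂ → ℝ} (hv : Continuous v) :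
    Continuous (TB c R v) := by
  rw [continuous_iff_continuousAt]
  intro z
  by_cases hz : z ∈ ball c R
  · exact (TB_harmonicAt hv.continuousOn.circleIntegrable' hz).1.continuousAt
  · rw [ContinuousAt, TB_out hz, ← nhdsWithin_univ, ← union_compl_self (ball c R), nhdsWithin_union]
    apply Tendsto.sup
    · by_cases hs : z ∈ sphere c R
      · refine (PI_tendsto hv hs).congr' ?_
        filter_upwards [self_mem_nhdsWithin] with w hw using (TB_in hw).symm
      · have : z ∉ closure (ball c R) := by
          intro h
          have := closure_ball_subset_closedBall h
          rw [← ball_union_sphere] at this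
          exact this.elim hz hs
        rw [notMem_closure_iff_nhdsWithin_eq_bot.1 this]
        exact tendsto_bot
    · refine (hv.continuousAt.tendsto.mono_left nhdsWithin_le_nhds).congr' ?_
      filter_upwards [self_mem_nhdsWithin] with w hw using (TB_out hw).symm

lemma TB_ge {c : ℂ} {R : ℝ} {v : ℂ → ℝ} (hv : Continuous v)
    (hs : ∀ z ∈ ball c R, SubMeanAt v z) (z : ℂ) : v z ≤ TB c R v z := by
  by_cases hz : z ∈ ball c R
  · have hT := TB_continuous (c := c) (R := R) hv
    have := max_principle (isCompact_closedBall c R) (φ := fun z => v z - TB c R v z)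
      (by fun_prop) (fun w _ hpos => by
        have hwb : w ∈ ball c R := by
          by_contra h
          rw [TB_out h] at hpos
          simp at hpos
        exact ⟨interior_mono ball_subset_closedBall (by rwa [isOpen_ball.interior_eq]),
          (hs w hwb).sub_harmonic univ_mem hv.continuousOn
            (TB_harmonicAt hv.continuousOn.circleIntegrable' hwb)⟩)
      z (ball_subset_closedBall hz)
    linarith
  · rw [TB_out hz]

def PClass (E : Set ℂ) (v0 v : ℂ → ℝ) : Prop :=
  Continuous v ∧ (∀ z ∉ E, SubMeanAt v z) ∧ (∀ z ∈ E, v z = v0 z) ∧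
    ∃ R : ℝ, ∀ z, R ≤ ‖z‖ → v z = v0 z

lemma TB_class {E : Set ℂ} {v0 v : ℂ → ℝ} {c : ℂ} {R : ℝ} (h : PClass E v0 v)
    (hd : ball c R ⊆ Eᶜ) : PClass E v0 (TB c R v) := by
  obtain ⟨h1, h2, h3, R0, h4⟩ := h
  refine ⟨TB_continuous h1, fun z hz => ?_, fun z hz => ?_, max R0 (‖c‖ + R), fun z hz => ?_⟩
  · by_cases hb : z ∈ ball c R
    · exact subMeanAt_of_harmonicAt (TB_harmonicAt h1.continuousOn.circleIntegrable' hb)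
    · obtain ⟨r0, hr0, h⟩ := h2 z hz
      refine ⟨r0, hr0, fun r hr hr' => ?_⟩
      rw [TB_out hb]
      refine (h r hr hr').trans (Real.circleAverage_mono h1.continuousOn.circleIntegrable'
        (TB_continuous h1).continuousOn.circleIntegrable' fun w _ => ?_)
      exact TB_ge h1 (fun z hz => h2 z (hd hz)) w
  · rw [TB_out (fun hb => hd hb hz)]
    exact h3 z hz
  · rw [TB_out]
    · exact h4 z ((le_max_left _ _).trans hz)
    · intro hb
      have h5 := (le_max_right _ _).trans hz
      rw [mem_ball, dist_eq_norm] at hb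
      have : ‖z‖ ≤ ‖z - c‖ + ‖c‖ := by
        calc ‖z‖ = ‖(z - c) + c‖ := by ring_nf
          _ ≤ _ := norm_add_le _ _
      linarith

lemma PI_dom {c w : ℂ} {R : ℝ} {v : ℕ → ℂ → ℝ} {u : ℂ → ℝ} (hv : ∀ k, Continuous (v k))
    {C : ℝ} (hC : ∀ k, ∀ z ∈ sphere c R, |v k z| ≤ C) (hu : ∀ z, Tendsto (fun k => v k z) atTop (nhds (u z)))
    (hw : w ∈ ball c R) :
    CircleIntegrable u c R ∧ Tendsto (fun k => PI c R (v k) w) atTop (nhds (PI c R u w)) := by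
  have hR : 0 < R := pos_of_mem_ball hw
  have hmu : Measurable u := measurable_of_tendsto_metrizable (fun k => (hv k).measurable)
    (tendsto_pi_nhds.2 hu)
  have hmem : ∀ θ, circleMap c R θ ∈ sphere c R := fun θ => circleMap_mem_sphere c hR.le θ
  have hKc : Continuous fun θ => poissonKernel c w (circleMap c R θ) :=
    (poissonKernel_cont_aux hw).comp_continuous (continuous_circleMap c R)
      (fun θ => by rw [abs_of_pos hR]; exact hmem θ)
  constructor
  · have hCu : ∀ z ∈ sphere c R, |u z| ≤ C := fun z hz =>
      le_of_tendsto (hu z).abs (Eventually.of_forall fun k => hC k z hz)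
    rw [CircleIntegrable, intervalIntegrable_iff]
    apply MeasureTheory.Measure.integrableOn_of_bounded (M := C) (by simp [ENNReal.mul_eq_top])
    · exact (hmu.comp (continuous_circleMap c R).measurable).aestronglyMeasurable
    · exact Eventually.of_forall fun θ => hCu _ (hmem θ)
  · simp only [PI, Real.circleAverage]
    apply Tendsto.const_smul
    apply intervalIntegral.tendsto_integral_filter_of_dominated_convergence
      (fun θ => poissonKernel c w (circleMap c R θ) * C)
    · apply Eventually.of_forall
      intro k
      have : Continuous fun θ => (poissonKernel c w • v k) (circleMap c R θ) :=
        hKc.mul ((hv k).comp (continuous_circleMap c R))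
      exact this.aestronglyMeasurable
    · apply Eventually.of_forall
      intro k
      apply Eventually.of_forall
      intro θ _
      have h0 := poissonKernel_nonneg_aux hw (hmem θ)
      rw [Pi.smul_apply', smul_eq_mul, norm_mul, Real.norm_of_nonneg h0]
      exact mul_le_mul_of_nonneg_left (hC k _ (hmem θ)) h0
    · exact (hKc.mul continuous_const).intervalIntegrable _ _
    · apply Eventually.of_forall
      intro θ _
      exact (hu _).const_mul _

theorem perron {E : Set ℂ} (hE : IsClosed E) (hne : Eᶜ.Nonempty) {v0 : ℂ → ℝ}
    (hv0 : Continuous v0) (hsub : ∀ z ∉ E, SubMeanAt v0 z) {A : ℝ}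
    (hA : ∀ v, PClass E v0 v → ∀ z, v z ≤ A * (1 + ‖z‖)) :
    ∃ u : ℂ → ℝ, (∀ z, v0 z ≤ u z) ∧ (∀ z b, (∀ v, PClass E v0 v → v z ≤ b) → u z ≤ b) ∧
      ∀ z ∉ E, HarmonicAt u z := by
  have hb : ∀ z : ℂ, ∃ r : ℝ, z ∉ E → 0 < r ∧ ball z r ⊆ Eᶜ := by
    intro z
    by_cases hz : z ∈ E
    · exact ⟨0, fun h => absurd hz h⟩
    · obtain ⟨r, hr, h⟩ := Metric.isOpen_iff.1 hE.isOpen_compl z hz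
      exact ⟨r, fun _ => ⟨hr, h⟩⟩
  choose r hr using hb
  obtain ⟨t, htE, htc, hcov⟩ := TopologicalSpace.countable_cover_nhdsWithin
    (s := Eᶜ) (f := fun z => ball z (r z)) (fun z hz => mem_nhdsWithin_of_mem_nhds
      (ball_mem_nhds z (hr z hz).1))
  have htne : t.Nonempty := by
    obtain ⟨x, hx⟩ := hne
    obtain ⟨i, hi, _⟩ := mem_iUnion₂.1 (hcov hx)
    exact ⟨i, hi⟩
  obtain ⟨e, he⟩ := htc.exists_eq_range htne
  have heE : ∀ j, e j ∉ E := fun j => htE (he ▸ mem_range_self j)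
  let v : ℕ → ℂ → ℝ := fun k => Nat.rec v0
    (fun k w => TB (e (Nat.unpair k).1) (r (e (Nat.unpair k).1)) w) k
  have hvs : ∀ k, v (k + 1) = TB (e (Nat.unpair k).1) (r (e (Nat.unpair k).1)) (v k) := fun k => rfl
  have hcl : ∀ k, PClass E v0 (v k) := by
    intro k
    induction k with
    | zero => exact ⟨hv0, hsub, fun _ _ => rfl, 0, fun _ _ => rfl⟩
    | succ k ih =>
      rw [hvs]
      exact TB_class ih (hr _ (heE _)).2
  have hmono : ∀ z, Monotone fun k => v k z := by
    intro z
    apply monotone_nat_of_le_succ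
    intro k
    rw [hvs]
    exact TB_ge (hcl k).1 (fun w hw => (hcl k).2.1 w ((hr _ (heE _)).2 hw)) z
  have hbdd : ∀ z, BddAbove (range fun k => v k z) := fun z =>
    ⟨A * (1 + ‖z‖), by rintro _ ⟨k, rfl⟩; exact hA _ (hcl k) z⟩
  have hlim : ∀ z, Tendsto (fun k => v k z) atTop (nhds (⨆ k, v k z)) := fun z =>
    tendsto_atTop_ciSup (hmono z) (hbdd z)
  refine ⟨fun z => ⨆ k, v k z, fun z => le_ciSup (hbdd z) 0, fun z b h => ciSup_le fun k => h _ (hcl k),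
    fun z hz => ?_⟩
  obtain ⟨i, hi, hzi⟩ := mem_iUnion₂.1 (hcov hz)
  rw [he] at hi
  obtain ⟨j, rfl⟩ := hi
  set c := e j
  set R := r (e j)
  have hC : ∃ C, ∀ k, ∀ z ∈ sphere c R, |v k z| ≤ C := by
    obtain ⟨C1, hC1⟩ := (isCompact_sphere c R).exists_bound_of_continuousOn hv0.continuousOn
    obtain ⟨C2, hC2⟩ := (isCompact_sphere c R).exists_bound_of_continuousOn
      (f := fun z : ℂ => A * (1 + ‖z‖)) (by fun_prop)
    refine ⟨max C1 C2, fun k z hz => abs_le.2 ⟨?_, ?_⟩⟩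
    · have h1 := hmono z (Nat.zero_le k)
      have h2 := (abs_le.1 (hC1 z hz)).1
      have : v 0 z = v0 z := rfl
      have := le_max_left C1 C2
      simp only at h1
      linarith
    · exact (hA _ (hcl k) z).trans ((le_abs_self _).trans ((hC2 z hz).trans (le_max_right _ _)))
  obtain ⟨C, hC⟩ := hC
  have hsubs : ∀ w ∈ ball c R, CircleIntegrable (fun z => ⨆ k, v k z) c R ∧
      (⨆ k, v k w) = PI c R (fun z => ⨆ k, v k z) w := by
    intro w hw
    have ht : Tendsto (fun i => Nat.pair j i) atTop atTop :=
      tendsto_atTop_mono (fun i => Nat.right_le_pair j i) tendsto_id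
    obtain ⟨h1, h2⟩ := PI_dom (v := fun i => v (Nat.pair j i)) (fun i => (hcl _).1)
      (fun i z hz => hC _ z hz) (fun z => (hlim z).comp ht) hw
    refine ⟨h1, tendsto_nhds_unique ?_ h2⟩
    have h3 := (hlim w).comp ((tendsto_add_atTop_nat 1).comp ht)
    refine h3.congr fun i => ?_
    simp only [Function.comp]
    rw [hvs, Nat.unpair_pair, TB_in hw]
  rw [harmonicAt_congr_nhds (f₂ := PI c R (fun z => ⨆ k, v k z))]
  · exact PI_harmonicAt (hsubs z hzi).1 hzi
  · filter_upwards [isOpen_ball.mem_nhds hzi] with w hw using (hsubs w hw).2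

end Part3

section Part4
open Complex Filter Set Metric InnerProductSpace

noncomputable def YB (τ r : ℝ) (s : ℂ) : ℝ := -(τ * s.re) / r + 2 * √((‖s‖ + τ * s.re) / (2 * r))

lemma YB_cont (τ r : ℝ) : Continuous (YB τ r) := by
  unfold YB; fun_prop

lemma YB_nonneg {τ r : ℝ} (hτ : |τ| = 1) (hr : 0 < r) {s : ℂ} (hs : ‖s‖ ≤ r) : 0 ≤ YB τ r s := by
  have h1 : |τ * s.re| ≤ ‖s‖ := by rw [abs_mul, hτ, one_mul]; exact abs_re_le_norm s
  obtain ⟨h2, h3⟩ := abs_le.1 h1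
  set a := τ * s.re
  unfold YB
  rcases le_or_gt a 0 with ha | ha
  · have : 0 ≤ -a / r := div_nonneg (by linarith) hr.le
    positivity
  · have h4 : a / r ≤ √((‖s‖ + a) / (2 * r)) := by
      apply Real.le_sqrt_of_sq_le
      rw [div_pow, div_le_div_iff₀ (by positivity) (by positivity)]
      nlinarith [mul_pos ha hr, mul_pos hr hr]
    have : 0 < a / r := by positivity
    rw [neg_div]
    linarith

lemma YB_ge_one {τ r : ℝ} (hτ : |τ| = 1) (hr : 0 < r) {s : ℂ} (hs : ‖s‖ = r) : 1 ≤ YB τ r s := by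
  have h1 : |τ * s.re| ≤ ‖s‖ := by rw [abs_mul, hτ, one_mul]; exact abs_re_le_norm s
  obtain ⟨h2, h3⟩ := abs_le.1 h1
  unfold YB
  set a := τ * s.re
  rw [hs] at *
  have h4 : (r + a) / (2 * r) ≤ √((r + a) / (2 * r)) := by
    apply Real.le_sqrt_of_sq_le
    have q1 : 0 ≤ (r + a) / (2 * r) := div_nonneg (by linarith) (by linarith)
    have q2 : (r + a) / (2 * r) ≤ 1 := by rw [div_le_one (by positivity)]; linarith
    nlinarith
  have : -a / r = 1 - 2 * ((r + a) / (2 * r)) := by field_simp; ring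
  rw [this]; linarith

lemma YB_le {τ r ε : ℝ} (hτ : |τ| = 1) (hr : 0 < r) (he0 : 0 ≤ ε) (he : ε ≤ 1) {s : ℂ}
    (hs : ‖s‖ ≤ ε * r) : YB τ r s ≤ 3 * √ε := by
  have h1 : |τ * s.re| ≤ ‖s‖ := by rw [abs_mul, hτ, one_mul]; exact abs_re_le_norm s
  obtain ⟨h2, h3⟩ := abs_le.1 h1
  unfold YB
  set a := τ * s.re
  have h4 : -a / r ≤ ε := by rw [div_le_iff₀ hr]; linarith
  have h5 : √((‖s‖ + a) / (2 * r)) ≤ √ε := by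
    apply Real.sqrt_le_sqrt
    rw [div_le_iff₀ (by positivity)]; linarith
  have h6 : ε ≤ √ε := Real.le_sqrt_of_sq_le (by nlinarith)
  linarith

lemma YB_harm {τ r : ℝ} (hτ : |τ| = 1) (hr : 0 < r) {s : ℂ} (hs : (τ : ℂ) * s ∈ slitPlane) :
    HarmonicAt (YB τ r) s := by
  have : YB τ r = fun s : ℂ => (-(τ * s) / r + ((2 / √r : ℝ) : ℂ) * ((τ : ℂ) * s) ^ (2⁻¹ : ℂ)).re := by
    ext s
    have e1 : ((-(τ * s) / r : ℂ)).re = -(τ * s.re) / r := by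
      rw [div_ofReal_re]; simp
    rw [add_re, re_ofReal_mul, Complex.cpow_inv_two_re, e1, YB]
    congr 1
    have e2 : ‖(τ : ℂ) * s‖ = ‖s‖ := by
      rw [norm_mul, norm_real, Real.norm_eq_abs, hτ, one_mul]
    rw [e2, re_ofReal_mul, ← div_div, Real.sqrt_div' _ hr.le]
    ring
  rw [this]
  apply AnalyticAt.harmonicAt_re
  apply AnalyticAt.add
  · have : (r : ℂ) ≠ 0 := by exact_mod_cast hr.ne'
    fun_prop (disch := assumption)
  · apply AnalyticAt.mul analyticAt_const
    apply AnalyticAt.cpow (by fun_prop) analyticAt_const hs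

lemma harmonicAt_comp_sub {h : ℂ → ℝ} {a z : ℂ} (H : HarmonicAt h (z - a)) :
    HarmonicAt (fun w => h (w - a)) z := by
  obtain ⟨e, he, hee⟩ := Metric.mem_nhds_iff.1 H.eventually
  obtain ⟨F, hF, hF2⟩ := InnerProductSpace.HarmonicOnNhd.exists_analyticOnNhd_ball_re_eq
    (f := h) (z := z - a) (R := e) (fun w hw => hee hw)
  rw [harmonicAt_congr_nhds (f₂ := fun w => (F (w - a)).re)]
  · apply AnalyticAt.harmonicAt_re
    exact AnalyticAt.fun_comp (f := fun w => w - a) (hF (z - a) (mem_ball_self he)) (by fun_prop)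
  · filter_upwards [ball_mem_nhds z he] with w hw
    have : w - a ∈ ball (z - a) e := by simpa [dist_eq_norm] using hw
    exact (hF2 this).symm

lemma HarmonicAt.const_mul' {h : ℂ → ℝ} {z : ℂ} (m : ℝ) (H : HarmonicAt h z) :
    HarmonicAt (fun w => m * h w) z := HarmonicAt.const_smul (c := m) H

lemma barrier {E : Set ℂ} {v : ℂ → ℝ} (hv : Continuous v) (hs : ∀ z ∉ E, SubMeanAt v z)
    (h0 : ∀ z ∈ E, v z = 0) {x0 r τ m : ℝ} (hτ : |τ| = 1) (hr : 0 < r) (hm : 0 ≤ m)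
    (hseg : ∀ t, 0 ≤ t → t ≤ r → ((x0 - τ * t : ℝ) : ℂ) ∈ E)
    (hb : ∀ z ∈ closedBall (x0 : ℂ) r, v z ≤ m) :
    ∀ z ∈ closedBall (x0 : ℂ) r, v z ≤ m * YB τ r (z - x0) := by
  intro z hz
  have hc := YB_cont τ r
  have := max_principle (isCompact_closedBall (x0:ℂ) r) (φ := fun z => v z - m * YB τ r (z - x0))
    (by fun_prop) (fun w hw hpos => by
      have hwn : ‖w - x0‖ ≤ r := by simpa [dist_eq_norm] using hw
      have hY := YB_nonneg hτ hr hwn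
      have hwE : w ∉ E := by
        intro h
        rw [h0 w h] at hpos
        nlinarith
      have hlt : ‖w - x0‖ < r := by
        refine lt_of_le_of_ne hwn fun h => ?_
        have := YB_ge_one hτ hr h
        have := hb w hw
        nlinarith
      have hsl : (τ : ℂ) * (w - x0) ∈ slitPlane := by
        by_contra hns
        rw [mem_slitPlane_iff] at hns
        push Not at hns
        obtain ⟨g1, g2⟩ := hns
        have hτ0 : τ ≠ 0 := by rintro rfl; simp at hτ
        have hτ2 : τ * τ = 1 := by rw [← abs_mul_abs_self, hτ]; norm_num
        simp [hτ0] at g1 g2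
        apply hwE
        have hw0 : w = ((x0 - τ * (-(τ * (w.re - x0))) : ℝ) : ℂ) := by
          apply Complex.ext
          · rw [ofReal_re]; linear_combination (-(w.re - x0)) * hτ2
          · simpa using g2
        rw [hw0]
        apply hseg
        · linarith
        · have : |τ * (w - x0).re| ≤ ‖w - x0‖ := by
            rw [abs_mul, hτ, one_mul]; exact abs_re_le_norm _
          rw [sub_re, ofReal_re] at this
          have := (abs_le.1 this).1
          linarith
      refine ⟨interior_mono ball_subset_closedBall ?_, ?_⟩
      · rw [isOpen_ball.interior_eq]; simpa [dist_eq_norm] using hlt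
      · exact (hs w hwE).sub_harmonic univ_mem hv.continuousOn
          (HarmonicAt.const_mul' m (harmonicAt_comp_sub (YB_harm hτ hr hsl))))
    z hz
  linarith

end Part4

section Part5
open Complex Filter Set Metric InnerProductSpace

lemma locFin {lam : ℕ → ℝ} (hfin : ∀ R : ℝ, {n | |lam n| ≤ R}.Finite) {D : ℝ}
    {s : ℕ → Set ℂ} (hs : ∀ n, s n ⊆ closedBall (lam n : ℂ) D) : LocallyFinite s := by
  intro z
  refine ⟨ball z 1, ball_mem_nhds z one_pos, (hfin (‖z‖ + 1 + D)).subset ?_⟩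
  rintro n ⟨w, hw, hwz⟩
  have h1 : ‖w - lam n‖ ≤ D := by simpa [dist_eq_norm] using hs n hw
  have h2 : ‖w - z‖ < 1 := by simpa [dist_eq_norm] using hwz
  have h3 : ‖(lam n : ℂ)‖ ≤ ‖z‖ + ‖w - z‖ + ‖w - lam n‖ := by
    calc ‖(lam n : ℂ)‖ = ‖z + (w - z) - (w - lam n)‖ := by ring_nf
      _ ≤ _ := (norm_sub_le _ _).trans (by gcongr; exact norm_add_le _ _)
  rw [norm_real, Real.norm_eq_abs] at h3
  simp only [mem_ofPred_eq]
  linarith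

lemma E_closed {lam : ℕ → ℝ} (hfin : ∀ R : ℝ, {n | |lam n| ≤ R}.Finite) {D : ℝ}
    {δ : ℕ → ℝ} (hD : ∀ n, δ n ≤ D) {E : Set ℝ}
    (hE : E = ⋃ n, Icc (lam n - δ n) (lam n + δ n)) : IsClosed (cplx E) := by
  have : cplx E = ⋃ n, (fun x : ℝ => (x : ℂ)) '' (Icc (lam n - δ n) (lam n + δ n)) := by
    rw [cplx, hE, image_iUnion]
  rw [this]
  apply LocallyFinite.isClosed_iUnion (locFin (lam := lam) (D := D) hfin _)
  · intro n
    exact (isCompact_Icc.image continuous_ofReal).isClosed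
  · rintro n _ ⟨x, hx, rfl⟩
    simp only [mem_closedBall, dist_eq_norm]
    rw [← ofReal_sub, norm_real, Real.norm_eq_abs, abs_le]
    have := hD n
    constructor <;> linarith [hx.1, hx.2]

theorem apriori {lam δ δ' : ℕ → ℝ} (hfin : ∀ R : ℝ, {n | |lam n| ≤ R}.Finite) {D : ℝ}
    (hδ : ∀ n, 0 < δ n) (hD : ∀ n, δ n ≤ D) {E : Set ℝ}
    (hE : E = ⋃ n, Icc (lam n - δ n) (lam n + δ n))
    (hδ' : ∀ n, δ' n = (1 / (6 * (1 + D)) / (1 + |lam n|)) ^ 2 * δ n)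
    {κ A0 : ℝ} (hκ : 0 ≤ κ) (hA0 : 0 ≤ A0) {W : ℂ → ℝ}
    (hW : ∀ z : ℂ, (∀ n, z ≠ lam n) → HarmonicAt W z)
    (hWl : ∀ z : ℂ, (∀ n, z ∉ ball (lam n : ℂ) (δ' n)) → κ * |z.im| ≤ W z)
    (hWu : ∀ z : ℂ, (∀ n, z ∉ ball (lam n : ℂ) (δ' n)) → W z ≤ A0 * (1 + ‖z‖))
    {v : ℂ → ℝ} (hv : PClass (cplx E) (fun z => κ * |z.im|) v) :
    ∀ z, v z ≤ (2 * A0) * (1 + ‖z‖) := by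
  obtain ⟨hvc, hvs, hv0, Rv, hvR⟩ := hv
  have hDpos : 0 < D := (hδ 0).trans_le (hD 0)
  have hv0' : ∀ z ∈ cplx E, v z = 0 := by
    intro z hz
    rw [hv0 z hz]
    obtain ⟨x, _, rfl⟩ := hz
    simp
  have hδ'pos : ∀ n, 0 < δ' n := fun n => by
    rw [hδ']; have := hδ n; positivity
  have heps : ∀ n, (1 / (6 * (1 + D)) / (1 + |lam n|)) ≤ 1 := by
    intro n
    rw [div_div, div_le_one (by positivity)]
    nlinarith [abs_nonneg (lam n)]
  have hδ'le : ∀ n, δ' n ≤ δ n := by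
    intro n
    rw [hδ' n]
    have : (1 / (6 * (1 + D)) / (1 + |lam n|)) ^ 2 ≤ 1 := pow_le_one₀ (by positivity) (heps n)
    nlinarith [hδ n]
  have step : ∀ A, 0 ≤ A → (∀ z, v z ≤ A * (1 + ‖z‖)) → ∀ z, v z ≤ (A0 + A / 2) * (1 + ‖z‖) := by
    intro A hA hAv
    have hnear : ∀ n, ∀ z ∈ closedBall (lam n : ℂ) (δ' n), v z ≤ A / 2 := by
      intro n z hz
      have hl := abs_nonneg (lam n)
      have hb := barrier (E := cplx E) hvc hvs hv0' (x0 := lam n) (r := δ n) (τ := 1)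
        (m := A * (1 + D) * (1 + |lam n|)) (by simp) (hδ n) (by positivity) (by
          intro t ht0 ht
          refine ⟨_, ?_, rfl⟩
          rw [hE]
          refine mem_iUnion.2 ⟨n, ?_⟩
          constructor <;> linarith [hδ n]) (by
          intro w hw
          have h1 : ‖w - lam n‖ ≤ δ n := by simpa [dist_eq_norm] using hw
          have h2 : ‖w‖ ≤ D + |lam n| := by
            calc ‖w‖ = ‖(w - lam n) + lam n‖ := by ring_nf
              _ ≤ ‖w - lam n‖ + ‖(lam n : ℂ)‖ := norm_add_le _ _
              _ ≤ _ := by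
                rw [norm_real, Real.norm_eq_abs]; linarith [hD n]
          refine (hAv w).trans ?_
          rw [mul_assoc]
          gcongr
          nlinarith) z (closedBall_subset_closedBall (hδ'le n) hz)
      have hY := YB_le (τ := 1) (r := δ n) (ε := (1 / (6 * (1 + D)) / (1 + |lam n|)) ^ 2)
        (by simp) (hδ n) (by positivity) (pow_le_one₀ (by positivity) (heps n))
        (s := z - lam n) (by rw [← hδ' n]; simpa [dist_eq_norm] using hz)
      rw [Real.sqrt_sq (by positivity)] at hY
      calc v z ≤ A * (1 + D) * (1 + |lam n|) * (3 * (1 / (6 * (1 + D)) / (1 + |lam n|))) :=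
            hb.trans (by gcongr)
        _ = A / 2 := by field_simp; ring
    intro z
    have hz1 : 1 ≤ 1 + ‖z‖ := by linarith [norm_nonneg z]
    by_cases hz : ∃ n, z ∈ ball (lam n : ℂ) (δ' n)
    · obtain ⟨n, hn⟩ := hz
      have := hnear n z (ball_subset_closedBall hn)
      nlinarith
    push Not at hz
    set K : Set ℂ := closedBall 0 (max Rv ‖z‖) \ ⋃ n, ball (lam n : ℂ) (δ' n) with hK
    have hKc : IsCompact K := (isCompact_closedBall _ _).diff (isOpen_iUnion fun n => isOpen_ball)
    have hKb : ∀ w ∈ K, ∀ n, w ∉ ball (lam n : ℂ) (δ' n) := fun w hw n h =>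
      hw.2 (mem_iUnion.2 ⟨n, h⟩)
    have hKl : ∀ w ∈ K, HarmonicAt W w := fun w hw => hW w fun n h =>
      hKb w hw n (h ▸ mem_ball_self (hδ'pos n))
    have hU : IsClosed (⋃ n, closedBall (lam n : ℂ) (δ' n)) :=
      LocallyFinite.isClosed_iUnion (locFin hfin (D := D) fun n =>
        closedBall_subset_closedBall ((hδ'le n).trans (hD n))) fun n => isClosed_closedBall
    have := max_principle hKc (φ := fun z => v z - (W z + A / 2))
      (hvc.continuousOn.sub (ContinuousOn.add (fun w hw => (hKl w hw).1.continuousAt.continuousWithinAt)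
        continuousOn_const))
      (fun w hw hpos => by
        have hWw := hWl w (hKb w hw)
        have h0 : 0 ≤ κ * |w.im| := by positivity
        have hwE : w ∉ cplx E := by
          intro h
          rw [hv0' w h] at hpos
          linarith
        have hwR : ‖w‖ < max Rv ‖z‖ := by
          by_contra h
          push Not at h
          rw [hvR w ((le_max_left _ _).trans h)] at hpos
          linarith
        have hwD : w ∉ ⋃ n, closedBall (lam n : ℂ) (δ' n) := by
          intro h
          obtain ⟨n, hn⟩ := mem_iUnion.1 h
          have := hnear n w hn
          linarith
        constructor
        · have hop : IsOpen (ball (0:ℂ) (max Rv ‖z‖) \ ⋃ n, closedBall (lam n : ℂ) (δ' n)) :=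
            isOpen_ball.sdiff hU
          refine mem_interior.2 ⟨_, ?_, hop, ⟨by simpa using hwR, hwD⟩⟩
          exact sdiff_subset_sdiff ball_subset_closedBall
            (iUnion_mono fun n => ball_subset_closedBall)
        · exact (hvs w hwE).sub_harmonic univ_mem hvc.continuousOn
            ((hKl w hw).add (harmonicAt_const _)))
      z ⟨by simp, fun h => by
        obtain ⟨n, hn⟩ := mem_iUnion.1 h
        exact hz n hn⟩
    have h2 := hWu z hz
    nlinarith
  set S : Set ℝ := {A | 0 ≤ A ∧ ∀ z, v z ≤ A * (1 + ‖z‖)} with hS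
  have hSne : S.Nonempty := by
    obtain ⟨C, hC⟩ := (isCompact_closedBall (0:ℂ) Rv).exists_bound_of_continuousOn hvc.continuousOn
    refine ⟨max (max C κ) 0, by simp, fun z => ?_⟩
    have hz1 : 0 ≤ ‖z‖ := norm_nonneg z
    rcases le_or_gt Rv ‖z‖ with h | h
    · rw [hvR z h]
      have h1 := abs_im_le_norm z
      have h2 : κ ≤ max (max C κ) 0 := by simp
      simp only
      gcongr
      linarith
    · have h1 := (le_abs_self _).trans (hC z (by simpa using h.le))
      have h2 : C ≤ max (max C κ) 0 := by simp
      have h3 : 0 ≤ max (max C κ) 0 := by simp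
      nlinarith
  have hbd : BddBelow S := ⟨0, fun A hA => hA.1⟩
  have hmem : sInf S ∈ S := by
    refine ⟨le_csInf hSne fun A hA => hA.1, fun z => ?_⟩
    have hz1 : 0 < 1 + ‖z‖ := by positivity
    rw [← div_le_iff₀ hz1]
    exact le_csInf hSne fun A hA => by rw [div_le_iff₀ hz1]; exact hA.2 z
  have h2 := csInf_le hbd (show A0 + sInf S / 2 ∈ S from
    ⟨by have := hmem.1; positivity, step _ hmem.1 hmem.2⟩)
  intro z
  refine (hmem.2 z).trans ?_
  gcongr
  linarith

end Part5

section Part6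
open Complex Filter Set Metric InnerProductSpace

lemma harnack_half {H : ℂ → ℝ} (hH : ∀ z : ℂ, 0 < z.im → HarmonicAt H z)
    (hpos : ∀ z : ℂ, 1 ≤ z.im → 0 ≤ H z) {z w : ℂ} (hz : 1 < z.im) (hw : 1 < w.im) :
    H w * ((z.im - 1) * (w.im - 1)) ≤ 8 * ((w.im - 1) / 2 + ‖w - z‖) ^ 2 * H z := by
  obtain ⟨R, hR⟩ : ∃ R : ℝ, R = 1 + ‖z - I‖ ^ 2 / (z.im - 1) + ‖w - I‖ ^ 2 / (w.im - 1) := ⟨_, rfl⟩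
  obtain ⟨c, hc⟩ : ∃ c : ℂ, c = (1 + R) * I := ⟨_, rfl⟩
  have hz1 : 0 < z.im - 1 := by linarith
  have hw1 : 0 < w.im - 1 := by linarith
  have hq1 : 0 ≤ ‖z - I‖ ^ 2 / (z.im - 1) := by positivity
  have hq2 : 0 ≤ ‖w - I‖ ^ 2 / (w.im - 1) := by positivity
  have hR1 : 1 ≤ R := by linarith
  have hRz : ‖z - I‖ ^ 2 ≤ R * (z.im - 1) := by
    rw [← div_le_iff₀ hz1]; linarith
  have hRw : ‖w - I‖ ^ 2 ≤ R * (w.im - 1) := by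
    rw [← div_le_iff₀ hw1]; linarith
  have hform : ∀ a : ℂ, R ^ 2 - ‖a - c‖ ^ 2 = 2 * R * (a.im - 1) - ‖a - I‖ ^ 2 := by
    intro a
    rw [← normSq_eq_norm_sq, ← normSq_eq_norm_sq, normSq_apply, normSq_apply, hc]
    simp
    ring
  have hzf := hform z
  have hwf := hform w
  have hzb : z ∈ ball c R := by
    rw [mem_ball, dist_eq_norm]
    apply lt_of_pow_lt_pow_left₀ 2 (by linarith)
    nlinarith
  have hwb : w ∈ ball c R := by
    rw [mem_ball, dist_eq_norm]
    apply lt_of_pow_lt_pow_left₀ 2 (by linarith)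
    nlinarith
  have hwb' : ‖w - c‖ < R := by simpa [dist_eq_norm] using hwb
  have him : ∀ a ∈ closedBall c R, 1 ≤ a.im := by
    intro a ha
    have h1 : ‖a - c‖ ≤ R := by simpa [dist_eq_norm] using ha
    have h2 := (abs_le.1 ((abs_im_le_norm (a - c)).trans h1)).1
    simp [hc] at h2
    linarith
  have hharm : HarmonicOnNhd H (closedBall c R) := fun a ha => hH a (by linarith [him a ha])
  have e1 := PI_harm hzb hharm
  have e2 := PI_harm hwb hharm
  obtain ⟨d, hd⟩ : ∃ d : ℝ, d = (w.im - 1) / 2 := ⟨_, rfl⟩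
  rw [← hd]
  have hdpos : 0 < d := by rw [hd]; positivity
  have hint : CircleIntegrable H c R := by
    apply ContinuousOn.circleIntegrable'
    rw [abs_of_pos (by linarith)]
    exact hharm.continuousOn.mono sphere_subset_closedBall
  obtain ⟨q, hq⟩ : ∃ q : ℝ, q = (z.im - 1) * (w.im - 1) / (8 * (d + ‖w - z‖) ^ 2) := ⟨_, rfl⟩
  have hq0 : 0 ≤ q := by rw [hq]; positivity
  have hker : ∀ ξ ∈ sphere c R, q * poissonKernel c w ξ ≤ poissonKernel c z ξ := by
    intro ξ hξ
    have hξ' : ‖ξ - c‖ = R := by simpa [dist_eq_norm] using hξ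
    rw [poissonKernel_def, poissonKernel_def, hξ', hzf, hwf]
    have a1 : ξ - c - (w - c) = ξ - w := by ring
    have a2 : ξ - c - (z - c) = ξ - z := by ring
    rw [a1, a2]
    have hdd : d ≤ ‖ξ - w‖ := by
      have : R ≤ ‖ξ - w‖ + ‖w - c‖ := by
        rw [← hξ']
        calc ‖ξ - c‖ = ‖(ξ - w) + (w - c)‖ := by ring_nf
          _ ≤ _ := norm_add_le _ _
      have h3 : R ^ 2 - ‖w - c‖ ^ 2 ≤ (R - ‖w - c‖) * (2 * R) := by
        nlinarith [norm_nonneg (w - c)]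
      have h4 : R * (w.im - 1) ≤ (R - ‖w - c‖) * (2 * R) := by linarith
      have h5 : d ≤ R - ‖w - c‖ := by
        rw [hd]; nlinarith
      linarith
    have hzn : ‖ξ - z‖ ≤ ‖ξ - w‖ + ‖w - z‖ := by
      calc ‖ξ - z‖ = ‖(ξ - w) + (w - z)‖ := by ring_nf
          _ ≤ _ := norm_add_le _ _
    have hzp : 0 < ‖ξ - z‖ := by
      rw [norm_pos_iff, sub_ne_zero]
      rintro rfl
      have := mem_ball.1 hzb
      have := mem_sphere.1 hξ
      linarith
    have hwp : 0 < ‖ξ - w‖ := by linarith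
    have hrat : d * ‖ξ - z‖ ≤ (d + ‖w - z‖) * ‖ξ - w‖ := by
      nlinarith [norm_nonneg (w - z)]
    have hrat2 : (d * ‖ξ - z‖) ^ 2 ≤ ((d + ‖w - z‖) * ‖ξ - w‖) ^ 2 := by
      gcongr
    calc q * ((2 * R * (w.im - 1) - ‖w - I‖ ^ 2) / ‖ξ - w‖ ^ 2)
        ≤ q * ((2 * R * (w.im - 1)) / ‖ξ - w‖ ^ 2) := by
          gcongr
          have : 0 ≤ ‖w - I‖ ^ 2 := by positivity
          linarith
      _ ≤ (R * (z.im - 1)) / ‖ξ - z‖ ^ 2 := by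
          rw [hq, div_mul_div_comm, div_le_div_iff₀ (by positivity) (by positivity)]
          have hR0 : 0 < R := by linarith
          have : w.im - 1 = 2 * d := by rw [hd]; ring
          rw [this]
          have hm : 0 ≤ 8 * R * (z.im - 1) := by positivity
          calc (z.im - 1) * (2 * d) * (2 * R * (2 * d)) * ‖ξ - z‖ ^ 2
              = 8 * R * (z.im - 1) * (d * ‖ξ - z‖) ^ 2 := by ring
            _ ≤ 8 * R * (z.im - 1) * ((d + ‖w - z‖) * ‖ξ - w‖) ^ 2 :=
              mul_le_mul_of_nonneg_left hrat2 hm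
            _ = _ := by ring
      _ ≤ _ := by
          gcongr
          linarith
  have key : q * H w ≤ H z := by
    rw [← e1, ← e2, PI, PI, ← smul_eq_mul, ← Real.circleAverage_fun_smul]
    apply Real.circleAverage_mono
    · exact (PI_integrable hwb hint).const_fun_smul
    · exact PI_integrable hzb hint
    · intro ξ hξ
      rw [abs_of_pos (by linarith)] at hξ
      have := mul_le_mul_of_nonneg_right (hker ξ hξ) (hpos ξ (him ξ (sphere_subset_closedBall hξ)))
      simp only [Pi.smul_apply', smul_eq_mul]
      linarith
  rw [hq, div_mul_eq_mul_div, div_le_iff₀ (by positivity)] at key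
  linarith

end Part6

section Part7
open Complex Filter Set Metric InnerProductSpace

lemma PL_sector {f : ℂ → ℂ} (hf : Differentiable ℂ f) {A1 : ℝ}
    (hA : ∀ z, ‖f z‖ ≤ Real.exp (A1 * (1 + ‖z‖))) {B ε : ℝ} (hε : 0 ≤ ε) {ζ : ℂ} (hζ : ‖ζ‖ = 1)
    (h1 : ∀ t : ℝ, 0 ≤ t → ‖f (ζ * t)‖ ≤ B * Real.exp (ε * t))
    (h2 : ∀ t : ℝ, 0 ≤ t → ‖f (ζ * I * t)‖ ≤ B * Real.exp (ε * t)) {w : ℂ} (hw1 : 0 ≤ w.re)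
    (hw2 : 0 ≤ w.im) : ‖f (ζ * w)‖ ≤ B * Real.exp (2 * ε * ‖w‖) := by
  have hexp : ∀ w : ℂ, ‖cexp (-(ε * (1 - I) * w))‖ = Real.exp (-(ε * (w.re + w.im))) := by
    intro w
    rw [Complex.norm_exp]
    congr 1
    simp
    ring
  have key : ‖f (ζ * w) * cexp (-(ε * (1 - I) * w))‖ ≤ B := by
    refine PhragmenLindelof.quadrant_I (f := fun w => f (ζ * w) * cexp (-(ε * (1 - I) * w))) ?_ ?_ ?_ ?_
      hw1 hw2
    · apply Differentiable.diffContOnCl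
      have : Differentiable ℂ fun w => f (ζ * w) := hf.comp (by fun_prop)
      fun_prop
    · refine ⟨1, by norm_num, A1, Asymptotics.IsBigO.of_bound (Real.exp A1) ?_⟩
      refine Filter.mem_inf_of_right ?_
      rw [mem_principal]
      intro z hz
      obtain ⟨z1, z2⟩ := mem_reProdIm.1 hz
      simp only [mem_Ioi] at z1 z2
      simp only [mem_ofPred_eq]
      rw [norm_mul, hexp, Real.rpow_one, Real.norm_eq_abs, Real.abs_exp, ← Real.exp_add]
      have e1 := hA (ζ * z)
      rw [norm_mul, hζ, one_mul] at e1
      have e2 : Real.exp (-(ε * (z.re + z.im))) ≤ 1 := by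
        rw [Real.exp_le_one_iff]
        have : 0 ≤ ε * (z.re + z.im) := by positivity
        linarith
      calc _ ≤ Real.exp (A1 * (1 + ‖z‖)) * 1 := by gcongr
        _ = _ := by rw [mul_one]; ring_nf
    · intro x hx
      rw [norm_mul, hexp]
      calc _ ≤ B * Real.exp (ε * x) * Real.exp (-(ε * x)) := by
            have := h1 x hx
            simp
            gcongr
        _ = B := by rw [mul_assoc, ← Real.exp_add]; simp
    · intro x hx
      rw [norm_mul, hexp]
      have := h2 x hx
      rw [mul_assoc, mul_comm I] at this
      calc _ ≤ B * Real.exp (ε * x) * Real.exp (-(ε * x)) := by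
            simp
            gcongr
        _ = B := by rw [mul_assoc, ← Real.exp_add]; simp
  rw [norm_mul, hexp, Real.exp_neg, ← div_eq_mul_inv, div_le_iff₀ (Real.exp_pos _)] at key
  have hB : 0 ≤ B := by
    have := (norm_nonneg _).trans (h1 0 le_rfl)
    simpa using this
  refine key.trans (mul_le_mul_of_nonneg_left (Real.exp_le_exp.2 ?_) hB)
  have := (le_abs_self _).trans (abs_re_le_norm w)
  have := (le_abs_self _).trans (abs_im_le_norm w)
  nlinarith

lemma exists_dir {f : ℂ → ℂ} (hf : Differentiable ℂ f) {A1 : ℝ}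
    (hA : ∀ z, ‖f z‖ ≤ Real.exp (A1 * (1 + ‖z‖))) {c : ℝ} (hc : 0 < c)
    (hty : ∀ R : ℝ, ∃ z, R ≤ ‖z‖ ∧ c * ‖z‖ ≤ Real.log ‖f z‖) :
    ∃ ζ : ℂ, ‖ζ‖ = 1 ∧ 1 / 2 ≤ |ζ.im| ∧
      ∀ B, ∃ t : ℝ, 0 ≤ t ∧ B * Real.exp (c / 4 * t) < ‖f (ζ * t)‖ := by
  by_contra! hcon
  obtain ⟨ζ0, h0n, h0r, h0i⟩ : ∃ ζ0 : ℂ, ‖ζ0‖ = 1 ∧ 1 / 2 ≤ |ζ0.re| ∧ 1 / 2 ≤ |ζ0.im| := by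
    refine ⟨(√2 / 2 : ℝ) + (√2 / 2 : ℝ) * I, ?_, ?_, ?_⟩
    · rw [norm_add_mul_I, Real.sqrt_eq_one, div_pow, Real.sq_sqrt (by norm_num)]
      norm_num
    · simp
      rw [abs_of_nonneg (by positivity)]
      have : 1 ≤ √2 := Real.one_le_sqrt.2 (by norm_num)
      linarith
    · simp
      rw [abs_of_nonneg (by positivity)]
      have : 1 ≤ √2 := Real.one_le_sqrt.2 (by norm_num)
      linarith
  obtain ⟨B0, hB0⟩ := hcon ζ0 h0n h0i
  obtain ⟨B1, hB1⟩ := hcon (ζ0 * I) (by simp [h0n]) (by simpa using h0r)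
  obtain ⟨B2, hB2⟩ := hcon (-ζ0) (by simp [h0n]) (by simpa using h0i)
  obtain ⟨B3, hB3⟩ := hcon (-(ζ0 * I)) (by simp [h0n]) (by simpa using h0r)
  obtain ⟨B, hBd⟩ : ∃ B, B = max (max B0 B1) (max B2 B3) := ⟨_, rfl⟩
  have up : ∀ {b : ℝ} {ζ : ℂ}, b ≤ B → (∀ t : ℝ, 0 ≤ t → ‖f (ζ * t)‖ ≤ b * Real.exp (c / 4 * t)) →
      (∀ t : ℝ, 0 ≤ t → ‖f (ζ * t)‖ ≤ B * Real.exp (c / 4 * t)) := fun hb h t ht =>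
    (h t ht).trans (by gcongr)
  replace hB0 := up (by simp [hBd]) hB0
  replace hB1 := up (by simp [hBd]) hB1
  replace hB2 := up (by simp [hBd]) hB2
  replace hB3 := up (by simp [hBd]) hB3
  have hz0 : ζ0 ≠ 0 := by rintro rfl; simp at h0n
  have hall : ∀ z, ‖f z‖ ≤ B * Real.exp (2 * (c / 4) * ‖z‖) := by
    intro z
    obtain ⟨y, rfl⟩ : ∃ y, z = ζ0 * y := ⟨z / ζ0, by field_simp⟩
    have hn : ‖ζ0 * y‖ = ‖y‖ := by rw [norm_mul, h0n, one_mul]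
    rw [hn]
    rcases le_or_gt 0 y.re with hr | hr <;> rcases le_or_gt 0 y.im with hi | hi
    · exact PL_sector hf hA (by positivity) h0n hB0 hB1 hr hi
    · have := PL_sector hf hA (ε := c / 4) (B := B) (ζ := -(ζ0 * I)) (w := I * y) (by positivity)
        (by simp [h0n]) hB3 (by
          intro t ht
          have e : -(ζ0 * I) * I * t = ζ0 * t := by linear_combination (-ζ0 * t) * I_sq
          rw [e]; exact hB0 t ht) (by simp; linarith) (by simpa using hr)
      have e : -(ζ0 * I) * (I * y) = ζ0 * y := by linear_combination (-ζ0 * y) * I_sq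
      rw [e] at this
      simpa using this
    · have := PL_sector hf hA (ε := c / 4) (B := B) (ζ := (ζ0 * I)) (w := -I * y) (by positivity)
        (by simp [h0n]) hB1 (by
          intro t ht
          have e : (ζ0 * I) * I * t = -ζ0 * t := by linear_combination (ζ0 * t) * I_sq
          rw [e]; exact hB2 t ht) (by simpa using hi) (by simp; linarith)
      have e : (ζ0 * I) * (-I * y) = ζ0 * y := by linear_combination (-ζ0 * y) * I_sq
      rw [e] at this
      simpa using this
    · have := PL_sector hf hA (ε := c / 4) (B := B) (ζ := -ζ0) (w := -y) (by positivity)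
        (by simp [h0n]) hB2 (by
          intro t ht
          have e : -ζ0 * I * t = -(ζ0 * I) * t := by ring
          rw [e]; exact hB3 t ht) (by simp; linarith) (by simp; linarith)
      simpa using this
  obtain ⟨z, hzR, hz⟩ := hty (2 / c * |B| + 1)
  have hzp : 0 < ‖z‖ := by
    have : 0 ≤ 2 / c * |B| := by positivity
    linarith
  have hfz : 0 < ‖f z‖ := by
    rw [norm_pos_iff]
    intro h
    rw [h] at hz
    simp at hz
    nlinarith
  have h3 := (Real.le_log_iff_exp_le hfz).1 hz
  have h4 := h3.trans (hall z)
  have e : c * ‖z‖ = c / 2 * ‖z‖ + 2 * (c / 4) * ‖z‖ := by ring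
  rw [e, Real.exp_add] at h4
  have h5 := le_of_mul_le_mul_right h4 (Real.exp_pos _)
  have h6 := Real.add_one_le_exp (c / 2 * ‖z‖)
  have h7 : c / 2 * (2 / c * |B| + 1) ≤ c / 2 * ‖z‖ := by gcongr
  have h8 : c / 2 * (2 / c * |B| + 1) = |B| + c / 2 := by field_simp
  have := le_abs_self B
  linarith

lemma half_lower {g : ℂ → ℂ} (hg : Differentiable ℂ g) {A1 : ℝ} (hA0 : 0 ≤ A1)
    (hA : ∀ z, ‖g z‖ ≤ Real.exp (A1 * (1 + ‖z‖))) {ε : ℝ} (hε : 0 < ε) {ζ : ℂ} (hζ : ‖ζ‖ = 1)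
    (hζi : 1 / 2 ≤ ζ.im) (hdir : ∀ B, ∃ t : ℝ, 0 ≤ t ∧ B * Real.exp (ε * t) < ‖g (ζ * t)‖)
    (hg0 : ∀ z : ℂ, 0 < z.im → g z ≠ 0) {C : ℝ} (hC0 : 0 ≤ C)
    (hC : ∀ z : ℂ, 1 ≤ z.im → -C ≤ Real.log ‖g z‖) :
    ∀ z : ℂ, 1 ≤ z.im → ε / 200 * (z.im - 1) - C ≤ Real.log ‖g z‖ := by
  intro z hz
  rcases hz.eq_or_lt with h | hz1
  · rw [← h]; have := hC z hz; linarith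
  obtain ⟨T, hT⟩ : ∃ T : ℝ, T = max 4 ‖z‖ := ⟨_, rfl⟩
  have hT4 : 4 ≤ T := by simp [hT]
  have hTz : ‖z‖ ≤ T := by simp [hT]
  obtain ⟨t, ht0, ht⟩ := hdir (Real.exp (A1 * (1 + T)))
  have hnt : ‖ζ * (t : ℂ)‖ = t := by rw [norm_mul, hζ, one_mul, norm_real, Real.norm_of_nonneg ht0]
  have htT : T ≤ t := by
    by_contra h
    push Not at h
    have h1 := hA (ζ * t)
    rw [hnt] at h1
    have h2 : Real.exp (A1 * (1 + t)) ≤ Real.exp (A1 * (1 + T)) := by gcongr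
    have h3 : 1 ≤ Real.exp (ε * t) := Real.one_le_exp (by positivity)
    have := Real.exp_pos (A1 * (1 + T))
    nlinarith
  have hlog : ε * t ≤ Real.log ‖g (ζ * t)‖ := by
    have h1 : 1 ≤ Real.exp (A1 * (1 + T)) := Real.one_le_exp (by positivity)
    have h2 : Real.exp (ε * t) < ‖g (ζ * t)‖ := by
      have := Real.exp_pos (ε * t)
      nlinarith
    exact (Real.le_log_iff_exp_le ((Real.exp_pos _).trans h2)).2 h2.le
  have him : (ζ * (t : ℂ)).im = ζ.im * t := by simp
  have hzi : ζ.im ≤ 1 := hζ ▸ (le_abs_self _).trans (abs_im_le_norm ζ)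
  have hp1 : t / 4 ≤ (ζ * (t : ℂ)).im - 1 := by rw [him]; nlinarith
  have hp2 : (ζ * (t : ℂ)).im - 1 ≤ t := by rw [him]; nlinarith
  have hn : ‖ζ * (t : ℂ) - z‖ ≤ 2 * t := by
    have := norm_sub_le (ζ * (t : ℂ)) z
    rw [hnt] at this
    linarith
  have hk := harnack_half (H := fun z => Real.log ‖g z‖ + C) (fun z hz =>
    ((hg.analyticAt z).harmonicAt_log_norm (hg0 z hz)).add (harmonicAt_const C))
    (fun z hz => by have := hC z hz; linarith) (z := z) (w := ζ * t) hz1 (by linarith)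
  obtain ⟨p, hp⟩ : ∃ p, p = (ζ * (t : ℂ)).im - 1 := ⟨_, rfl⟩
  rw [← hp] at hk hp1 hp2
  have hzC := hC z hz
  have hHz : 0 ≤ Real.log ‖g z‖ + C := by linarith
  have hz0 : 0 < z.im - 1 := by linarith
  have hb : 8 * (p / 2 + ‖ζ * (t : ℂ) - z‖) ^ 2 ≤ 50 * t ^ 2 := by
    have h1 : p / 2 + ‖ζ * (t : ℂ) - z‖ ≤ 5 / 2 * t := by linarith
    have h2 : 0 ≤ p / 2 + ‖ζ * (t : ℂ) - z‖ := by
      have := norm_nonneg (ζ * (t : ℂ) - z)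
      linarith
    nlinarith
  have ht4 : 4 ≤ t := by linarith
  have hl : ε * t * ((z.im - 1) * (t / 4)) ≤ 50 * t ^ 2 * (Real.log ‖g z‖ + C) := by
    calc ε * t * ((z.im - 1) * (t / 4)) ≤ (Real.log ‖g (ζ * t)‖ + C) * ((z.im - 1) * p) := by
          have het : 0 ≤ ε * t := by positivity
          gcongr
          · linarith
          · linarith
      _ ≤ _ := hk
      _ ≤ _ := by gcongr
  have h9 : 50 * t ^ 2 * (ε / 200 * (z.im - 1)) ≤ 50 * t ^ 2 * (Real.log ‖g z‖ + C) := by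
    refine le_trans (le_of_eq ?_) hl
    ring
  have := le_of_mul_le_mul_left h9 (by positivity)
  linarith

lemma type_lower {f : ℂ → ℂ} (hf : Differentiable ℂ f) {A1 : ℝ} (hA0 : 0 ≤ A1)
    (hA : ∀ z, ‖f z‖ ≤ Real.exp (A1 * (1 + ‖z‖))) {c : ℝ} (hc : 0 < c)
    (hty : ∀ R : ℝ, ∃ z, R ≤ ‖z‖ ∧ c * ‖z‖ ≤ Real.log ‖f z‖)
    (hf0 : ∀ z : ℂ, z.im ≠ 0 → f z ≠ 0) {C : ℝ} (hC0 : 0 ≤ C)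
    (hC : ∀ z : ℂ, 1 ≤ |z.im| → -C ≤ Real.log ‖f z‖) :
    ∃ κ > 0, ∀ z : ℂ, 1 ≤ |z.im| →
      κ * (|z.im| - 1) - 2 * C ≤ Real.log ‖f z‖ + Real.log ‖f (starRingEnd ℂ z)‖ := by
  obtain ⟨ζ, hζ, hζi, hdir⟩ := exists_dir hf hA hc hty
  refine ⟨c / 4 / 200, by positivity, fun z hz => ?_⟩
  have hcz : 1 ≤ |((starRingEnd ℂ) z).im| := by simpa using hz
  have k1 := hC z hz
  have k2 := hC _ hcz
  rcases le_abs.1 hζi with h | h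
  · have hl := half_lower hf hA0 hA (by positivity) hζ h hdir (fun z hz => hf0 z hz.ne') hC0
      (fun z hz => hC z (hz.trans (le_abs_self _)))
    rcases le_or_gt 0 z.im with hi | hi
    · rw [abs_of_nonneg hi] at hz ⊢
      have := hl z hz
      linarith
    · rw [abs_of_neg hi] at hz ⊢
      have := hl (starRingEnd ℂ z) (by simpa using hz)
      simp only [conj_im] at this
      linarith
  · have hl := half_lower (g := fun z => f (-z)) (ζ := -ζ) (ε := c / 4) (hf.comp differentiable_neg) hA0
      (fun z => by simpa using hA (-z)) (by positivity) (by simpa using hζ) (by simpa using h)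
      (by simpa using hdir) (fun z hz => hf0 (-z) (by simpa using hz.ne')) hC0
      (fun z hz => hC (-z) (by simpa using (hz.trans (le_abs_self _))))
    rcases le_or_gt 0 z.im with hi | hi
    · rw [abs_of_nonneg hi] at hz ⊢
      have := hl (-(starRingEnd ℂ z)) (by simpa using hz)
      simp only [neg_neg, neg_im, conj_im] at this
      linarith
    · rw [abs_of_neg hi] at hz ⊢
      have := hl (-z) (by simpa using hz)
      simp only [neg_neg, neg_im] at this
      linarith

end Part7

section Part8
open Complex Filter Set Metric InnerProductSpace

lemma zeros_finite {f : ℂ → ℂ} {lam : ℕ → ℝ} (hf : Differentiable ℂ f) (hinj : Function.Injective lam)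
    (hz : ∀ n, f (lam n) = 0) (hd : ∀ n, deriv f (lam n) ≠ 0) (R : ℝ) :
    {n | |lam n| ≤ R}.Finite := by
  by_contra hinf
  have hinf : {n | |lam n| ≤ R}.Infinite := hinf
  have hinj' : Function.Injective fun n => (lam n : ℂ) := ofReal_injective.comp hinj
  have h1 : ((fun n => (lam n : ℂ)) '' {n | |lam n| ≤ R}).Infinite := hinf.image hinj'.injOn
  obtain ⟨x, _, hx⟩ := h1.exists_accPt_of_subset_isCompact (isCompact_closedBall (0:ℂ) R) (by
    rintro _ ⟨n, hn, rfl⟩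
    simpa using hn)
  rw [accPt_iff_frequently_nhdsNE] at hx
  have h2 : ∃ᶠ z in nhdsWithin x {x}ᶜ, f z = 0 := hx.mono (by
    rintro _ ⟨n, _, rfl⟩
    exact hz n)
  have h3 := AnalyticOnNhd.eqOn_zero_of_preconnected_of_frequently_eq_zero (U := univ)
    (fun z _ => hf.analyticAt z) isPreconnected_univ (mem_univ x) h2
  apply hd 0
  have : f = fun _ => 0 := funext fun z => h3 (mem_univ z)
  rw [this]; simp

lemma zeros_count {f : ℂ → ℂ} {lam : ℕ → ℝ} (hf : Differentiable ℂ f) (hinj : Function.Injective lam)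
    (hz : ∀ n, f (lam n) = 0) (hd : ∀ n, deriv f (lam n) ≠ 0) (hI : f I ≠ 0)
    {A1 : ℝ} (hA0 : 0 ≤ A1) (hA : ∀ z, ‖f z‖ ≤ Real.exp (A1 * (1 + ‖z‖))) :
    ∃ C : ℝ, 0 ≤ C ∧ ∀ ρ : ℝ, 0 ≤ ρ → ∀ s : Finset ℕ, (∀ n ∈ s, |lam n| ≤ ρ) →
      (s.card : ℝ) ≤ C * (1 + ρ) := by
  have hl2 : 0 < Real.log 2 := Real.log_pos (by norm_num)
  refine ⟨(4 * A1 + |Real.log ‖f I‖|) / Real.log 2, by positivity, fun ρ hρ s hs => ?_⟩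
  have hr : 0 < ρ + 1 := by linarith
  have hr2 : 0 < 2 * (ρ + 1) := by linarith
  have hJ := AnalyticOnNhd.sum_divisor_le (c := I) (r := ρ + 1) (R := 2 * (ρ + 1))
    (M := Real.exp (A1 * (4 + 2 * ρ))) (f := f) (by rw [abs_of_pos hr]; exact hr)
    (by rw [abs_of_pos hr, abs_of_pos hr2]; linarith) (Real.one_le_exp (by positivity))
    (fun z _ => hf.analyticAt z) hI (by
      intro z hz
      rw [abs_of_pos hr2] at hz
      have h1 : ‖z - I‖ = 2 * (ρ + 1) := by simpa [dist_eq_norm] using hz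
      refine (hA z).trans ?_
      have h2 : ‖z‖ ≤ 2 * (ρ + 1) + 1 := by
        calc ‖z‖ = ‖(z - I) + I‖ := by ring_nf
          _ ≤ ‖z - I‖ + ‖I‖ := norm_add_le _ _
          _ = _ := by rw [h1]; simp
      have : 1 + ‖z‖ ≤ 4 + 2 * ρ := by linarith
      gcongr)
  rw [abs_of_pos hr] at hJ
  have han : AnalyticOnNhd ℂ f (closedBall I (ρ + 1)) := fun z _ => hf.analyticAt z
  set Dv := MeromorphicOn.divisor f (closedBall I (ρ + 1)) with hDv
  have hnn : ∀ u, 0 ≤ Dv u := fun u => MeromorphicOn.AnalyticOnNhd.divisor_nonneg han u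
  have hfs : (Function.support Dv).Finite := Dv.finiteSupport (isCompact_closedBall _ _)
  have hge : ∀ n ∈ s, 1 ≤ Dv (lam n) := by
    intro n hn
    have hmem : (lam n : ℂ) ∈ closedBall I (ρ + 1) := by
      rw [mem_closedBall, dist_eq_norm]
      calc _ ≤ ‖(lam n : ℂ)‖ + ‖I‖ := norm_sub_le _ _
        _ ≤ _ := by rw [norm_real, Real.norm_eq_abs, norm_I]; linarith [hs n hn]
    rw [hDv, MeromorphicOn.AnalyticOnNhd.divisor_apply han hmem]
    have h1 : analyticOrderAt f (lam n) ≠ 0 :=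
      (hf.analyticAt _).analyticOrderAt_ne_zero.2 (hz n)
    have h2 : analyticOrderAt f (lam n) ≠ ⊤ := by
      intro h
      rw [analyticOrderAt_eq_top] at h
      apply hd n
      have : f =ᶠ[nhds (lam n : ℂ)] fun _ => 0 := h
      rw [this.deriv_eq]; simp
    obtain ⟨k, hk⟩ := ENat.ne_top_iff_exists.1 h2
    rw [← hk] at h1 ⊢
    have : k ≠ 0 := by exact_mod_cast h1
    simp
    omega
  have hinj' : Function.Injective fun n => (lam n : ℂ) := ofReal_injective.comp hinj
  classical
  have hsum : ((s.card : ℤ)) ≤ ∑ᶠ u, Dv u := by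
    rw [finsum_eq_sum_of_support_subset (s := hfs.toFinset ∪ s.image fun n => (lam n : ℂ)) _ (by
      intro u hu; simp; left; exact hu)]
    calc ((s.card : ℤ)) = ∑ n ∈ s, (1 : ℤ) := by simp
      _ ≤ ∑ n ∈ s, Dv (lam n) := Finset.sum_le_sum hge
      _ = ∑ u ∈ s.image fun n => (lam n : ℂ), Dv u := by
        rw [Finset.sum_image hinj'.injOn]
      _ ≤ _ := Finset.sum_le_sum_of_subset_of_nonneg Finset.subset_union_right
        fun u _ _ => hnn u
  have hsum' : (s.card : ℝ) ≤ ((∑ᶠ u, Dv u : ℤ) : ℝ) := by exact_mod_cast hsum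
  refine hsum'.trans (hJ.trans ?_)
  have e : 2 * (ρ + 1) / (ρ + 1) = 2 := by field_simp
  rw [e, div_mul_eq_mul_div]
  gcongr
  rw [Real.log_div (Real.exp_pos _).ne' (by simpa using hI), Real.log_exp]
  have := neg_abs_le (Real.log ‖f I‖)
  nlinarith [abs_nonneg (Real.log ‖f I‖)]

lemma growth {f : ℂ → ℂ} (hf : Differentiable ℂ f)
    (hf_type : 0 < Filter.limsup (fun z : ℂ => Real.log ‖f z‖ / ‖z‖)
      (Filter.comap (fun z : ℂ => ‖z‖) Filter.atTop)) :
    (∃ A1 : ℝ, 0 ≤ A1 ∧ ∀ z, ‖f z‖ ≤ Real.exp (A1 * (1 + ‖z‖))) ∧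
    ∃ c > 0, ∀ R : ℝ, ∃ z, R ≤ ‖z‖ ∧ c * ‖z‖ ≤ Real.log ‖f z‖ := by
  rw [Filter.limsup_eq] at hf_type
  set S := {a : ℝ | ∀ᶠ z : ℂ in Filter.comap (fun z : ℂ => ‖z‖) Filter.atTop,
    Real.log ‖f z‖ / ‖z‖ ≤ a} with hS
  constructor
  · have hne : S.Nonempty := by
      by_contra h
      rw [not_nonempty_iff_eq_empty] at h
      rw [h] at hf_type
      simp at hf_type
    obtain ⟨a, ha⟩ := hne
    rw [hS, mem_ofPred_eq, eventually_comap, eventually_atTop] at ha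
    obtain ⟨R, hR⟩ := ha
    obtain ⟨C, hC⟩ := (isCompact_closedBall (0:ℂ) (max R 1)).exists_bound_of_continuousOn
      hf.continuous.continuousOn
    refine ⟨|a| + |C|, by positivity, fun z => ?_⟩
    have hzn := norm_nonneg z
    rcases le_or_gt ‖z‖ (max R 1) with h | h
    · calc ‖f z‖ ≤ C := hC z (by simpa using h)
        _ ≤ |C| := le_abs_self C
        _ ≤ (|a| + |C|) * (1 + ‖z‖) := by nlinarith [abs_nonneg a, abs_nonneg C]
        _ ≤ _ := by linarith [Real.add_one_le_exp ((|a| + |C|) * (1 + ‖z‖))]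
    · have h1 : R ≤ ‖z‖ := (le_max_left _ _).trans h.le
      have h2 : 1 ≤ ‖z‖ := (le_max_right _ _).trans h.le
      have h3 := hR ‖z‖ h1 z rfl
      rw [div_le_iff₀ (by linarith)] at h3
      by_cases hfz : f z = 0
      · rw [hfz]; simp; exact (Real.exp_pos _).le
      · rw [← Real.log_le_iff_le_exp (by simpa using hfz)]
        refine h3.trans ?_
        nlinarith [le_abs_self a, abs_nonneg a, abs_nonneg C]
  · have hbb : BddBelow S := by
      by_contra h
      rw [Real.sInf_of_not_bddBelow h] at hf_type
      exact lt_irrefl _ hf_type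
    refine ⟨sInf S / 2, by positivity, fun R => ?_⟩
    by_contra! hcon
    have : sInf S / 2 ∈ S := by
      rw [hS, mem_ofPred_eq, eventually_comap, eventually_atTop]
      refine ⟨max R 1, ?_⟩
      rintro _ hb z rfl
      have h2 : 1 ≤ ‖z‖ := (le_max_right _ _).trans hb
      rw [div_le_iff₀ (by linarith)]
      exact (hcon z ((le_max_left _ _).trans hb)).le
    have := csInf_le hbb this
    linarith

end Part8

section Part9
open Complex Filter Set Metric InnerProductSpace

lemma krein_inv_le {f : ℂ → ℂ} {lam : ℕ → ℝ} (hk : KreinClass f lam) {z : ℂ} (hz : f z ≠ 0)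
    {g : ℕ → ℝ} (hg : Summable g) (h : ∀ n, 1 / ‖deriv f (lam n)‖ / ‖z - lam n‖ ≤ g n) :
    1 / ‖f z‖ ≤ ∑' n, g n := by
  obtain ⟨h1, h2⟩ := hk.2.2.2.2.2 z hz
  have : 1 / ‖f z‖ = ‖1 / f z‖ := by simp
  rw [this, h2]
  refine (norm_tsum_le_tsum_norm h1).trans (h1.tsum_le_tsum (fun n => ?_) hg)
  refine le_trans (le_of_eq ?_) (h n)
  rw [norm_div, norm_mul, norm_one, div_div]

lemma log_lower {a K : ℝ} (ha : 0 < a) (h : 1 / a ≤ K) : - Real.log K ≤ Real.log a := by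
  have := Real.log_le_log (by positivity) h
  rw [one_div, Real.log_inv] at this
  linarith

lemma krein_K2 {f : ℂ → ℂ} {lam : ℕ → ℝ} (hk : KreinClass f lam) :
    ∃ C, 0 ≤ C ∧ ∀ z : ℂ, 1 ≤ |z.im| → -C ≤ Real.log ‖f z‖ := by
  have hs := hk.2.2.2.2.1
  have hS : 0 ≤ ∑' n, 1 / ‖deriv f (lam n)‖ := tsum_nonneg fun n => by positivity
  refine ⟨Real.log (1 + ∑' n, 1 / ‖deriv f (lam n)‖), Real.log_nonneg (by linarith), fun z hz => ?_⟩
  have hfz : f z ≠ 0 := by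
    intro h0
    obtain ⟨n, rfl⟩ := (hk.2.2.1 z).1 h0
    simp at hz; linarith
  apply log_lower (norm_pos_iff.2 hfz)
  have := krein_inv_le hk hfz hs (fun n => by
    apply div_le_self (by positivity)
    have := abs_im_le_norm (z - lam n)
    simp at this; linarith)
  linarith

lemma krein_K5 {f : ℂ → ℂ} {lam : ℕ → ℝ} (hk : KreinClass f lam)
    {M : ℝ} (hM : 0 ≤ M) {δ δ' : ℕ → ℝ}
    (hδ : ∀ n, δ n = 1 / ((1 + |lam n| ^ M) * ‖deriv f (lam n)‖)) {D : ℝ} (hD : 0 ≤ D)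
    (hδ' : ∀ n, δ' n = (1 / (6 * (1 + D)) / (1 + |lam n|)) ^ 2 * δ n) {C : ℝ} (hC : 0 ≤ C)
    (hfin : ∀ R : ℝ, {n | |lam n| ≤ R}.Finite)
    (hcount : ∀ ρ, 0 ≤ ρ → ∀ s : Finset ℕ, (∀ n ∈ s, |lam n| ≤ ρ) → (s.card : ℝ) ≤ C * (1 + ρ)) :
    ∃ C5, 0 ≤ C5 ∧ ∀ z : ℂ, (∀ n, z ∉ ball (lam n : ℂ) (δ' n)) →
      -(C5 + (3 + M) * Real.log (2 + ‖z‖)) ≤ Real.log ‖f z‖ := by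
  have hs := hk.2.2.2.2.1
  have hd := hk.2.2.2.1
  obtain ⟨S, hSdef⟩ : ∃ S, S = ∑' n, 1 / ‖deriv f (lam n)‖ := ⟨_, rfl⟩
  have hS : 0 ≤ S := by rw [hSdef]; exact tsum_nonneg fun n => by positivity
  refine ⟨Real.log (1 + S + C * (2 * (6 * (1 + D)) ^ 2)), Real.log_nonneg (by
    have : 0 ≤ C * (2 * (6 * (1 + D)) ^ 2) := by positivity
    linarith), fun z hz => ?_⟩
  have hδ0 : ∀ n, 0 < δ' n := fun n => by
    rw [hδ', hδ]
    have := norm_pos_iff.2 (hd n)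
    positivity
  have hfz : f z ≠ 0 := by
    intro h0
    obtain ⟨n, rfl⟩ := (hk.2.2.1 z).1 h0
    exact hz n (mem_ball_self (hδ0 n))
  obtain ⟨X, hX⟩ : ∃ X, X = 2 + ‖z‖ := ⟨_, rfl⟩
  have hX2 : 2 ≤ X := by have := norm_nonneg z; linarith
  obtain ⟨P, hP⟩ : ∃ P, P = (6 * (1 + D) * X) ^ 2 * (2 * X ^ M) := ⟨_, rfl⟩
  have hP0 : 0 ≤ P := by rw [hP]; positivity
  have hXM : 1 ≤ X ^ M := Real.one_le_rpow (by linarith) hM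
  obtain ⟨s, hsdef⟩ : ∃ s : Finset ℕ, s = (hfin (‖z‖ + 1)).toFinset := ⟨_, rfl⟩
  have hmem : ∀ n, n ∈ s ↔ |lam n| ≤ ‖z‖ + 1 := fun n => by rw [hsdef]; simp
  have hterm : ∀ n, 1 / ‖deriv f (lam n)‖ / ‖z - lam n‖ ≤
      1 / ‖deriv f (lam n)‖ + if n ∈ s then P else 0 := by
    intro n
    have hdn := norm_pos_iff.2 (hd n)
    have hc0 : 0 ≤ 1 / ‖deriv f (lam n)‖ := by positivity
    by_cases hn : n ∈ s
    · rw [if_pos hn]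
      rw [hmem] at hn
      have h1 : δ' n ≤ ‖z - lam n‖ := by
        have := hz n
        rw [mem_ball, not_lt, dist_eq_norm] at this
        exact this
      have hpos : 0 < ‖z - lam n‖ := (hδ0 n).trans_le h1
      suffices 1 / ‖deriv f (lam n)‖ / ‖z - lam n‖ ≤ P by linarith
      rw [div_le_iff₀ hpos]
      have hl := abs_nonneg (lam n)
      have hlM : |lam n| ^ M ≤ X ^ M := Real.rpow_le_rpow hl (by linarith) hM
      have h2 : 1 / ‖deriv f (lam n)‖ =
          ((6 * (1 + D) * (1 + |lam n|)) ^ 2 * (1 + |lam n| ^ M)) * δ' n := by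
        rw [hδ', hδ]
        have : (1 + |lam n| ^ M) ≠ 0 := by positivity
        have : (1 + |lam n|) ≠ 0 := by positivity
        have : 1 + D ≠ 0 := by positivity
        field_simp
      rw [h2]
      apply mul_le_mul _ h1 (hδ0 n).le hP0
      rw [hP]
      gcongr
      · linarith
      · linarith
    · rw [if_neg hn, add_zero]
      rw [hmem, not_le] at hn
      apply div_le_self hc0
      have := norm_sub_norm_le (lam n : ℂ) z
      rw [norm_sub_rev, norm_real, Real.norm_eq_abs] at this
      linarith
  have hfs : Summable fun n => if n ∈ s then P else 0 :=
    summable_of_ne_finset_zero (s := s) (fun n hn => by simp [hn])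
  have h3 := krein_inv_le hk hfz (hs.add hfs) hterm
  rw [hs.tsum_add hfs, ← hSdef, tsum_eq_sum (s := s) (fun n hn => by simp [hn]),
    Finset.sum_ite_mem, Finset.inter_self, Finset.sum_const, nsmul_eq_mul] at h3
  have h4 := hcount (‖z‖ + 1) (by positivity) s (fun n hn => (hmem n).1 hn)
  have h5 : (s.card : ℝ) * P ≤ C * X * P := by
    apply mul_le_mul_of_nonneg_right _ hP0
    rw [hX]; linarith
  have hXX : X ^ (3 + M) = X ^ 3 * X ^ M := by
    rw [Real.rpow_add (by linarith)]; norm_cast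
  have h1X : 1 ≤ X ^ (3 + M) := Real.one_le_rpow (by linarith) (by linarith)
  have h6 : 1 / ‖f z‖ ≤ (1 + S + C * (2 * (6 * (1 + D)) ^ 2)) * X ^ (3 + M) := by
    have e : C * X * P = C * (2 * (6 * (1 + D)) ^ 2) * X ^ (3 + M) := by rw [hXX, hP]; ring
    nlinarith
  have h7 := log_lower (norm_pos_iff.2 hfz) h6
  rw [Real.log_mul (by positivity) (by positivity), Real.log_rpow (by linarith)] at h7
  rw [← hX]; exact h7

end Part9

section Part10
open Complex Filter Set Metric InnerProductSpace

lemma krein_W {f : ℂ → ℂ} {lam : ℕ → ℝ} (hk : KreinClass f lam)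
    (hf_type : 0 < Filter.limsup (fun z : ℂ => Real.log ‖f z‖ / ‖z‖)
      (Filter.comap (fun z : ℂ => ‖z‖) Filter.atTop))
    {M : ℝ} (hM : 0 ≤ M) {δ δ' : ℕ → ℝ}
    (hδ : ∀ n, δ n = 1 / ((1 + |lam n| ^ M) * ‖deriv f (lam n)‖)) {D : ℝ} (hD : 0 ≤ D)
    (hδ' : ∀ n, δ' n = (1 / (6 * (1 + D)) / (1 + |lam n|)) ^ 2 * δ n)
    (hfin : ∀ R : ℝ, {n | |lam n| ≤ R}.Finite) :
    ∃ κ A0 : ℝ, 0 < κ ∧ 0 ≤ A0 ∧ ∃ W : ℂ → ℝ, (∀ z : ℂ, (∀ n, z ≠ lam n) → HarmonicAt W z) ∧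
    (∀ z : ℂ, (∀ n, z ∉ ball (lam n : ℂ) (δ' n)) → κ * |z.im| ≤ W z) ∧
    (∀ z : ℂ, (∀ n, z ∉ ball (lam n : ℂ) (δ' n)) → W z ≤ A0 * (1 + ‖z‖)) := by
  have hdiff := hk.1
  have hinj := hk.2.1
  have hzero := hk.2.2.1
  have hd := hk.2.2.2.1
  have hf0 : ∀ z : ℂ, z.im ≠ 0 → f z ≠ 0 := by
    intro z hz h0
    obtain ⟨n, rfl⟩ := (hzero z).1 h0
    simp at hz
  obtain ⟨⟨A1, hA1, hA⟩, c, hc, hty⟩ := growth hdiff hf_type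
  obtain ⟨N, hN, hcount⟩ := zeros_count hdiff hinj (fun n => (hzero _).2 ⟨n, rfl⟩) hd
    (hf0 I (by simp)) hA1 hA
  obtain ⟨C, hC0, hC⟩ := krein_K2 hk
  obtain ⟨C5, hC5, hK5⟩ := krein_K5 hk hM hδ hD hδ' hN hfin hcount
  obtain ⟨κ, hκ, hlow⟩ := type_lower hdiff hA1 hA hc hty hf0 hC0 hC
  have hδ0 : ∀ n, 0 < δ' n := fun n => by
    rw [hδ', hδ]
    have := norm_pos_iff.2 (hd n)
    positivity
  obtain ⟨C1, hC1⟩ : ∃ x, x = 2 * (3 + M) := ⟨_, rfl⟩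
  have hC10 : 0 ≤ C1 := by rw [hC1]; positivity
  obtain ⟨Q, hQ⟩ : ∃ x, x = 1 + (2 + |lam 0|) / δ' 0 := ⟨_, rfl⟩
  have hd0 := hδ0 0
  have hQ1 : 1 ≤ Q := by
    rw [hQ]; have : 0 ≤ (2 + |lam 0|) / δ' 0 := by positivity
    linarith
  obtain ⟨C6, hC6⟩ : ∃ x, x = Real.log Q := ⟨_, rfl⟩
  have hC60 : 0 ≤ C6 := by rw [hC6]; exact Real.log_nonneg hQ1
  obtain ⟨C2, hC2⟩ : ∃ x, x = 2 * C5 + C1 * C6 + κ + 2 * C := ⟨_, rfl⟩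
  have hC16 : 0 ≤ C1 * C6 := by positivity
  have hC20 : 0 ≤ C2 := by rw [hC2]; positivity
  have hconj : ∀ z : ℂ, (∀ n, z ∉ ball (lam n : ℂ) (δ' n)) →
      ∀ n, (starRingEnd ℂ z) ∉ ball (lam n : ℂ) (δ' n) := by
    intro z hz n h
    apply hz n
    rw [mem_ball, dist_eq_norm] at h ⊢
    rw [← Complex.norm_conj]; simpa using h
  refine ⟨κ, 2 * A1 + C1 * (1 + |lam 0|) + C2, hκ, by positivity,
    fun z => Real.log ‖f z‖ + Real.log ‖f (starRingEnd ℂ z)‖ + C1 * Real.log ‖z - lam 0‖ + C2,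
    ?_, ?_, ?_⟩
  · intro z hz
    have hne : ∀ w : ℂ, (∀ n, w ≠ lam n) → f w ≠ 0 := by
      intro w hw h0
      obtain ⟨n, hn⟩ := (hzero w).1 h0
      exact hw n hn
    have h1 : HarmonicAt (fun z => Real.log ‖f z‖) z :=
      (hdiff.analyticAt z).harmonicAt_log_norm (hne z hz)
    have h2 : HarmonicAt (fun z => Real.log ‖f (starRingEnd ℂ z)‖) z := by
      have hdc : Differentiable ℂ (fun w => starRingEnd ℂ (f (starRingEnd ℂ w))) :=
        fun w => differentiableAt_conj_conj_iff.2 (hdiff _)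
      have := (hdc.analyticAt z).harmonicAt_log_norm (by
        simp only [ne_eq, map_eq_zero]
        apply hne
        intro n hn
        apply hz n
        rw [← Complex.conj_conj z, hn, conj_ofReal])
      simpa only [Complex.norm_conj] using this
    have h3 : HarmonicAt (fun z : ℂ => Real.log ‖z - lam 0‖) z := by
      have hdc : Differentiable ℂ (fun w : ℂ => w - lam 0) := by fun_prop
      exact (hdc.analyticAt z).harmonicAt_log_norm (sub_ne_zero.2 (hz 0))
    exact ((h1.add h2).add (HarmonicAt.const_mul' C1 h3)).add (harmonicAt_const C2)
  · intro z hz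
    have hz0 : δ' 0 ≤ ‖z - lam 0‖ := by
      have := hz 0
      rw [mem_ball, not_lt, dist_eq_norm] at this
      exact this
    rcases le_total 1 (|z.im|) with h | h
    · have h1 := hlow z h
      have h2 : 0 ≤ Real.log ‖z - lam 0‖ := by
        apply Real.log_nonneg
        have := abs_im_le_norm (z - lam 0)
        simp at this; linarith
      have := mul_nonneg hC10 h2
      show _ ≤ _ + _ + _ + _
      linarith
    · have h1 := hK5 z hz
      have h2 := hK5 _ (hconj z hz)
      rw [Complex.norm_conj] at h2
      have h3 : Real.log (2 + ‖z‖) ≤ C6 + Real.log ‖z - lam 0‖ := by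
        rw [hC6, ← Real.log_mul (by positivity) (by linarith)]
        apply Real.log_le_log (by positivity)
        have h4 : ‖z‖ ≤ ‖z - lam 0‖ + |lam 0| := by
          have := norm_add_le (z - lam 0) (lam 0 : ℂ)
          simpa using this
        rw [hQ, add_mul, one_mul]
        have : 2 + |lam 0| ≤ (2 + |lam 0|) / δ' 0 * ‖z - lam 0‖ := by
          rw [div_mul_eq_mul_div, le_div_iff₀ hd0]
          gcongr
        linarith
      have h5 := mul_le_mul_of_nonneg_left h3 hC10
      have h6 : κ * |z.im| ≤ κ := mul_le_of_le_one_right hκ.le h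
      have h7 : C1 * Real.log (2 + ‖z‖) = 2 * ((3 + M) * Real.log (2 + ‖z‖)) := by rw [hC1]; ring
      show _ ≤ _ + _ + _ + _
      linarith
  · intro z hz
    have hn : ∀ w : ℂ, (∀ n, w ∉ ball (lam n : ℂ) (δ' n)) → Real.log ‖f w‖ ≤ A1 * (1 + ‖w‖) := by
      intro w hw
      have hfw : f w ≠ 0 := by
        intro h0
        obtain ⟨n, rfl⟩ := (hzero w).1 h0
        exact hw n (mem_ball_self (hδ0 n))
      rw [Real.log_le_iff_le_exp (norm_pos_iff.2 hfw)]
      exact hA w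
    have h1 := hn z hz
    have h2 := hn _ (hconj z hz)
    rw [Complex.norm_conj] at h2
    have h3 : Real.log ‖z - lam 0‖ ≤ (1 + |lam 0|) * (1 + ‖z‖) := by
      have h4 : ‖z - lam 0‖ ≤ ‖z‖ + |lam 0| := by
        have := norm_sub_le z (lam 0 : ℂ)
        simpa using this
      have := Real.log_le_self (norm_nonneg (z - lam 0))
      nlinarith [norm_nonneg z, abs_nonneg (lam 0)]
    have h5 := mul_le_mul_of_nonneg_left h3 hC10
    have h6 : 0 ≤ C2 * ‖z‖ := by positivity
    show _ + _ + _ + _ ≤ _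
    nlinarith

end Part10

section Part11
open Complex Filter Set Metric InnerProductSpace

lemma subMeanAt_abs_im {κ : ℝ} (hκ : 0 ≤ κ) (z : ℂ) : SubMeanAt (fun z => κ * |z.im|) z := by
  obtain ⟨s, hs, hz⟩ : ∃ s : ℝ, |s| = 1 ∧ |z.im| = s * z.im := by
    rcases le_total 0 z.im with h | h
    · exact ⟨1, by simp, by rw [abs_of_nonneg h, one_mul]⟩
    · exact ⟨-1, by simp, by rw [abs_of_nonpos h]; ring⟩
  have hh : HarmonicAt (fun w : ℂ => κ * (s * w.im)) z :=
    HarmonicAt.const_mul' κ (HarmonicAt.const_mul' s (analyticAt_id.harmonicAt_im (f := id)))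
  obtain ⟨r0, hr0, h⟩ := subMeanAt_of_harmonicAt hh
  refine ⟨r0, hr0, fun r hr hr' => ?_⟩
  have h1 := h r hr hr'
  simp only [hz] at h1 ⊢
  refine h1.trans (Real.circleAverage_mono ?_ ?_ ?_)
  · apply Continuous.continuousOn (by fun_prop) |>.circleIntegrable hr.le
  · apply Continuous.continuousOn (by fun_prop) |>.circleIntegrable hr.le
  · intro w _
    apply mul_le_mul_of_nonneg_left _ hκ
    calc s * w.im ≤ |s * w.im| := le_abs_self _
      _ = |w.im| := by rw [abs_mul, hs, one_mul]

lemma harmonicAt_comp_conj {h : ℂ → ℝ} {z : ℂ} (H : HarmonicAt h (starRingEnd ℂ z)) :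
    HarmonicAt (fun w => h (starRingEnd ℂ w)) z := by
  obtain ⟨e, he, hee⟩ := Metric.mem_nhds_iff.1 H.eventually
  obtain ⟨F, hF1, hF2⟩ := HarmonicOnNhd.exists_analyticOnNhd_ball_re_eq (f := h)
    (z := starRingEnd ℂ z) (R := e) (fun w hw => hee hw)
  have hmem : ∀ w ∈ ball z e, starRingEnd ℂ w ∈ ball (starRingEnd ℂ z) e := by
    intro w hw
    rw [mem_ball, dist_eq_norm, ← map_sub, Complex.norm_conj]
    simpa [dist_eq_norm] using hw
  have hd : DifferentiableOn ℂ (fun w => starRingEnd ℂ (F (starRingEnd ℂ w))) (ball z e) :=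
    fun w hw => (differentiableAt_conj_conj_iff.2
      (hF1 _ (hmem w hw)).differentiableAt).differentiableWithinAt
  have ha : AnalyticAt ℂ (fun w => starRingEnd ℂ (F (starRingEnd ℂ w))) z :=
    hd.analyticAt (ball_mem_nhds z he)
  refine (harmonicAt_congr_nhds ?_).1 ha.harmonicAt_re
  filter_upwards [ball_mem_nhds z he] with w hw
  have := hF2 (hmem w hw)
  simp only at this
  simp [this]

lemma harmonicOn_of_harmonicAt {h : ℂ → ℝ} {U : Set ℂ} (hU : IsOpen U)
    (H : ∀ z ∈ U, HarmonicAt h z) : HarmonicOn h U := by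
  refine ⟨fun z hz => (H z hz).1.contDiffWithinAt, fun z hz => ?_⟩
  rw [iteratedFDerivWithin_of_isOpen 2 hU hz]
  have := (H z hz).2.self_of_nhds
  rw [laplacian_eq_iteratedFDeriv_complexPlane] at this
  exact this

lemma seg_in {lam δ : ℕ → ℝ} (hδ : ∀ n, 0 < δ n) {E : Set ℝ}
    (hE : E = ⋃ n, Icc (lam n - δ n) (lam n + δ n)) {x : ℝ} (hx : x ∈ E) :
    ∃ τ r : ℝ, |τ| = 1 ∧ 0 < r ∧ ∀ t, 0 ≤ t → t ≤ r → ((x - τ * t : ℝ) : ℂ) ∈ cplx E := by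
  rw [hE, mem_iUnion] at hx
  obtain ⟨n, hn⟩ := hx
  have hsub : Icc (lam n - δ n) (lam n + δ n) ⊆ E := by
    rw [hE]; exact subset_iUnion (fun n => Icc (lam n - δ n) (lam n + δ n)) n
  rcases le_total (lam n) x with h | h
  · refine ⟨1, δ n, by simp, hδ n, fun t h0 h1 => ⟨_, hsub ?_, rfl⟩⟩
    constructor <;> linarith [hn.1, hn.2]
  · refine ⟨-1, δ n, by simp, hδ n, fun t h0 h1 => ⟨_, hsub ?_, rfl⟩⟩
    constructor <;> linarith [hn.1, hn.2]

lemma finish {lam δ : ℕ → ℝ} (hδ : ∀ n, 0 < δ n) {E : Set ℝ}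
    (hE : E = ⋃ n, Icc (lam n - δ n) (lam n + δ n)) (hcl : IsClosed (cplx E))
    {κ A : ℝ} (hκ : 0 < κ) (hA0 : 0 ≤ A)
    (hA : ∀ v, PClass (cplx E) (fun z => κ * |z.im|) v → ∀ z, v z ≤ A * (1 + ‖z‖)) :
    ∃ u : ℂ → ℝ, Continuous u ∧ (∀ x ∈ E, u (x : ℂ) = 0) ∧
      (∀ z ∈ (cplx E)ᶜ, 0 < u z) ∧ (∀ z ∈ (cplx E)ᶜ, HarmonicAt u z) ∧
      (∀ z : ℂ, u z ≤ A * (1 + ‖z‖)) ∧ (∀ z : ℂ, κ * |z.im| ≤ u z) := by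
  obtain ⟨u, h1, h2, h3⟩ := perron (A := A) (v0 := fun z => κ * |z.im|) hcl
    ⟨I, by rintro ⟨x, _, hx⟩; have := congrArg im hx; simp at this⟩
    (by fun_prop) (fun z _ => subMeanAt_abs_im hκ.le z) hA
  have hu0 : ∀ z, 0 ≤ u z := fun z => le_trans (by positivity) (h1 z)
  have hbar : ∀ x ∈ E, ∃ τ r m : ℝ, 0 < r ∧ ∀ z ∈ closedBall (x : ℂ) r,
      u z ≤ m * YB τ r (z - x) := by
    intro x hx
    obtain ⟨τ, r, hτ, hr, hseg⟩ := seg_in hδ hE hx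
    refine ⟨τ, r, A * (1 + (|x| + r)), hr, fun z hz => h2 z _ fun v hv => ?_⟩
    refine barrier hv.1 hv.2.1 (fun w hw => ?_) hτ hr (by positivity) hseg (fun w hw => ?_) z hz
    · rw [hv.2.2.1 w hw]
      obtain ⟨y, _, rfl⟩ := hw
      simp
    · refine (hA v hv w).trans ?_
      gcongr
      have := norm_add_le (w - x) (x : ℂ)
      have h' : ‖w - x‖ ≤ r := by simpa [dist_eq_norm] using hw
      rw [norm_real, Real.norm_eq_abs, sub_add_cancel] at this
      linarith
  have hYB0 : ∀ τ r, YB τ r 0 = 0 := by intro τ r; simp [YB]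
  have hzero : ∀ x ∈ E, u (x : ℂ) = 0 := by
    intro x hx
    obtain ⟨τ, r, m, hr, h⟩ := hbar x hx
    have := h x (mem_closedBall_self hr.le)
    rw [sub_self, hYB0, mul_zero] at this
    exact le_antisymm this (hu0 _)
  have hcont : Continuous u := by
    rw [continuous_iff_continuousAt]
    intro z
    by_cases hz : z ∈ cplx E
    · obtain ⟨x, hx, rfl⟩ := hz
      obtain ⟨τ, r, m, hr, h⟩ := hbar x hx
      show Tendsto u (nhds (x:ℂ)) (nhds (u (x:ℂ)))
      rw [hzero x hx]
      have hlim : Tendsto (fun z : ℂ => m * YB τ r (z - x)) (nhds (x : ℂ)) (nhds 0) := by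
        have hc : Continuous (fun z : ℂ => m * YB τ r (z - x)) :=
          continuous_const.mul ((YB_cont τ r).comp (continuous_id.sub continuous_const))
        have := hc.tendsto (x : ℂ)
        simpa [hYB0] using this
      exact tendsto_of_tendsto_of_tendsto_of_le_of_le' tendsto_const_nhds hlim
        (Eventually.of_forall hu0) (by
          filter_upwards [closedBall_mem_nhds (x : ℂ) hr] with w hw using h w hw)
    · exact (h3 z hz).1.continuousAt
  refine ⟨u, hcont, hzero, fun z hz => ?_, h3, fun z => h2 z _ fun v hv => hA v hv z, h1⟩
  by_cases him : z.im = 0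
  · refine lt_of_le_of_ne (hu0 z) fun h0 => ?_
    obtain ⟨e, he, hee⟩ := Metric.mem_nhds_iff.1 (h3 z hz).eventually
    have hav : Real.circleAverage (-u) z (e / 2) = (-u) z := by
      apply InnerProductSpace.HarmonicOnNhd.circleAverage_eq
      intro w hw
      rw [abs_of_pos (by positivity)] at hw
      exact (hee (closedBall_subset_ball (by linarith) hw)).neg
    have := circleAverage_lt_aux (φ := -u) (z := z) (w0 := z + (e / 2 : ℝ) * I) (r := e / 2) (M := 0)
      (by positivity) hcont.neg.continuousOn (fun w _ => by simpa using hu0 w)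
      (by rw [mem_sphere, dist_eq_norm]; simp [abs_of_pos he])
      (by
        have := h1 (z + (e / 2 : ℝ) * I)
        have hp : 0 < κ * |(z + (e / 2 : ℝ) * I).im| := by
          simp [him]
          have : 0 < |e| := abs_pos.2 he.ne'
          positivity
        have := hp.trans_le this
        simpa using this)
    rw [hav, Pi.neg_apply, ← h0] at this
    simp at this
  · exact lt_of_lt_of_le (by positivity) (h1 z)

end Part11

section Part12
open Complex Filter Set Metric InnerProductSpace

lemma krein_main (f : ℂ → ℂ) (lam : ℕ → ℝ) (hf : KreinClass f lam)
    (hf_type : 0 < Filter.limsup (fun z : ℂ => Real.log ‖f z‖ / ‖z‖)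
      (Filter.comap (fun z : ℂ => ‖z‖) Filter.atTop))
    (M : ℝ) (hM : 0 ≤ M)
    (δ : ℕ → ℝ) (hδ : ∀ n, δ n = 1 / ((1 + |lam n| ^ M) * ‖deriv f (lam n)‖))
    (E : Set ℝ) (hE : E = ⋃ n, Icc (lam n - δ n) (lam n + δ n)) :
    ∃ u : ℂ → ℝ, ∃ κ : ℝ, 0 < κ ∧
      Continuous u ∧ (∀ x ∈ E, u (x : ℂ) = 0) ∧
      (∀ z ∈ (cplx E)ᶜ, 0 < u z) ∧ HarmonicOn u (cplx E)ᶜ ∧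
      (∀ z : ℂ, u (starRingEnd ℂ z) = u z) ∧
      (∃ A : ℝ, ∀ z : ℂ, u z ≤ A * (1 + ‖z‖)) ∧
      (∀ z : ℂ, κ * |z.im| ≤ u z) := by
  have hd := hf.2.2.2.1
  have hs := hf.2.2.2.2.1
  have hfin := zeros_finite hf.1 hf.2.1 (fun n => (hf.2.2.1 _).2 ⟨n, rfl⟩) hd
  have hδ0 : ∀ n, 0 < δ n := fun n => by
    rw [hδ]
    have := norm_pos_iff.2 (hd n)
    positivity
  obtain ⟨D, hD⟩ : ∃ D, D = ∑' n, 1 / ‖deriv f (lam n)‖ := ⟨_, rfl⟩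
  have hδD : ∀ n, δ n ≤ D := by
    intro n
    have h1 : 1 / ‖deriv f (lam n)‖ ≤ D := by
      rw [hD]; exact hs.le_tsum n (fun m _ => by positivity)
    refine le_trans ?_ h1
    rw [hδ]
    have := norm_pos_iff.2 (hd n)
    apply one_div_le_one_div_of_le this
    have h2 : 0 ≤ |lam n| ^ M := by positivity
    nlinarith
  have hD0 : 0 ≤ D := (hδ0 0).le.trans (hδD 0)
  obtain ⟨κ, A0, hκ, hA0, W, hW, hWl, hWu⟩ := krein_W hf hf_type hM hδ hD0
    (δ' := fun n => (1 / (6 * (1 + D)) / (1 + |lam n|)) ^ 2 * δ n) (fun n => rfl) hfin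
  have hcl := E_closed hfin hδD hE
  obtain ⟨u, hc, hz, hp, hh, hA, hl⟩ := finish hδ0 hE hcl hκ (A := 2 * A0) (by positivity)
    (fun v hv => apriori hfin hδ0 hδD hE (fun n => rfl) hκ.le hA0 hW hWl hWu hv)
  have hconj : ∀ z ∈ (cplx E)ᶜ, starRingEnd ℂ z ∈ (cplx E)ᶜ := by
    rintro z hz ⟨x, hx, h⟩
    refine hz ⟨x, hx, ?_⟩
    rw [← Complex.conj_conj z, ← h]; simp
  refine ⟨fun z => 2⁻¹ * (u z + u (starRingEnd ℂ z)), κ, hκ, ?_, ?_, ?_, ?_, ?_, ⟨2 * A0, ?_⟩, ?_⟩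
  · exact continuous_const.mul (hc.add (hc.comp continuous_conj))
  · intro x hx; simp [hz x hx]
  · intro z hz
    have := hp z hz
    have := hp _ (hconj z hz)
    positivity
  · apply harmonicOn_of_harmonicAt hcl.isOpen_compl
    intro z hz
    exact HarmonicAt.const_mul' _ ((hh z hz).add (harmonicAt_comp_conj (hh _ (hconj z hz))))
  · intro z; simp [add_comm]
  · intro z
    have h1 := hA z
    have h2 := hA (starRingEnd ℂ z)
    rw [Complex.norm_conj] at h2
    show 2⁻¹ * (_ + _) ≤ _
    linarith
  · intro z
    have h1 := hl z
    have h2 := hl (starRingEnd ℂ z)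
    rw [conj_im, abs_neg] at h2
    show _ ≤ 2⁻¹ * (_ + _)
    linarith

end Part12

theorem stmt9 (f : ℂ → ℂ) (lam : ℕ → ℝ) (hf : KreinClass f lam)
    (hf_type : 0 < Filter.limsup (fun z : ℂ => Real.log ‖f z‖ / ‖z‖)
      (Filter.comap (fun z : ℂ => ‖z‖) Filter.atTop))
    (M : ℝ) (hM : 0 ≤ M)
    (δ : ℕ → ℝ) (hδ : ∀ n, δ n = 1 / ((1 + |lam n| ^ M) * ‖deriv f (lam n)‖))
    (E : Set ℝ) (hE : E = ⋃ n, Icc (lam n - δ n) (lam n + δ n)) :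
    ∃ u : ℂ → ℝ, ∃ κ : ℝ, 0 < κ ∧
      Continuous u ∧ (∀ x ∈ E, u (x : ℂ) = 0) ∧
      (∀ z ∈ (cplx E)ᶜ, 0 < u z) ∧ HarmonicOn u (cplx E)ᶜ ∧
      (∀ z : ℂ, u (starRingEnd ℂ z) = u z) ∧
      (∃ A : ℝ, ∀ z : ℂ, u z ≤ A * (1 + ‖z‖)) ∧
      (∀ z : ℂ, κ * |z.im| ≤ u z) := by
  exact krein_main f lam hf hf_type M hM δ hδ E hE
end

section
/- Let E ⊆ ℝ be a nonempty closed set. Let M : ℂ → ℝ be continuous on ℂ, equal to 0 on E, positive and harmonic on ℂ∖E, symmetric (M(conj z) = M(z) for all z), and satisfy M(z) ≤ A(1+|z|) for some constant A. Let h be a positive harmonic function on ℂ∖E with h(conj z) = h(z) for all z ∈ ℂ∖E, and suppose there is no ε > 0 such that h(z) ≥ ε·M(z) for all z ∈ ℂ∖E. Then h(iy)/M(iy) → 0 as y → +∞. -/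
open Complex Filter Set

section
open InnerProductSpace Metric Topology

lemma aux_harm {f : ℂ → ℝ} {U : Set ℂ} (hU : IsOpen U) (hf : HarmonicOn f U) :
    HarmonicOnNhd f U := by
  intro z hz
  refine ⟨hf.1.contDiffAt (hU.mem_nhds hz), ?_⟩
  filter_upwards [hU.mem_nhds hz] with w hw
  rw [laplacian_eq_iteratedFDeriv_complexPlane]
  have := hf.2 w hw
  rw [iteratedFDerivWithin_of_isOpen 2 hU hw] at this
  simpa using this

lemma aux_localmax {f : ℂ → ℝ} {z : ℂ} (hf : HarmonicAt f z) (hm : IsLocalMax f z) :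
    ∀ᶠ w in 𝓝 z, f w = f z := by
  obtain ⟨r, hr, hr2⟩ := Metric.eventually_nhds_iff_ball.1 hf.eventually
  obtain ⟨F, hF, hFe⟩ := HarmonicOnNhd.exists_analyticOnNhd_ball_re_eq (f := f) (z := z) (R := r) hr2
  have hb : ball z r ∈ 𝓝 z := ball_mem_nhds z hr
  have h1 : ∀ᶠ w in 𝓝 z, DifferentiableAt ℂ (fun w => Complex.exp (F w)) w := by
    filter_upwards [hb] with w hw
    exact (hF w hw).differentiableAt.cexp
  have h2 : IsLocalMax (norm ∘ (fun w => Complex.exp (F w))) z := by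
    filter_upwards [hb, hm] with w hw hw2
    have e1 := hFe hw
    have e2 := hFe (mem_ball_self hr)
    simp only [Function.comp, Complex.norm_exp] at *
    rw [e1, e2]
    exact Real.exp_le_exp.2 hw2
  have h3 := Complex.eventually_eq_of_isLocalMax_norm h1 h2
  filter_upwards [h3, hb] with w hw hw2
  have e1 := hFe hw2
  have e2 := hFe (mem_ball_self hr)
  have := congrArg norm hw
  simp only [Complex.norm_exp] at *
  rw [e1, e2] at this
  exact Real.exp_injective this

lemma aux_maxp {Q O S : Set ℂ} (hQ : IsCompact Q) (hO : IsOpen O) (hOQ : O ⊆ Q) (hS : IsClosed S)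
    {u k : ℂ → ℝ} (hu : ContinuousOn u Q) (hk : ContinuousOn k Sᶜ) (hk0 : ∀ z ∈ Sᶜ, 0 ≤ k z)
    (hharm : HarmonicOnNhd (fun z => u z - k z) (O ∩ Sᶜ))
    (huS : ∀ z ∈ Q ∩ S, u z ≤ 0) (hbd : ∀ z ∈ Q, z ∉ O → z ∉ S → u z ≤ k z) :
    ∀ z ∈ O ∩ Sᶜ, u z ≤ k z := by
  intro z0 hz0
  by_contra hcon
  push Not at hcon
  set m := u z0 - k z0 with hm
  have hmpos : 0 < m := by simp only [hm]; linarith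
  set T := {z ∈ Q | m ≤ u z} with hT
  have hTc : IsCompact T := by
    apply hQ.of_isClosed_subset _ (fun z hz => hz.1)
    have := hu.preimage_isClosed_of_isClosed hQ.isClosed (isClosed_Ici (a := m))
    exact this
  have hTS : T ⊆ Sᶜ := by
    intro z hz hzs
    have := huS z ⟨hz.1, hzs⟩
    have := hz.2
    linarith
  have hfc : ContinuousOn (fun z => u z - k z) T :=
    (hu.mono (fun z hz => hz.1)).sub (hk.mono hTS)
  have hz0T : z0 ∈ T := ⟨hOQ hz0.1, by have := hk0 z0 hz0.2; simp only [hm]; linarith⟩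
  obtain ⟨z1, hz1T, hz1⟩ := hTc.exists_isMaxOn ⟨z0, hz0T⟩ hfc
  have hz1m : m ≤ u z1 - k z1 := hz1 hz0T
  set P := {z ∈ T | u z1 - k z1 ≤ u z - k z} with hP
  have hPcl : IsClosed P := hfc.preimage_isClosed_of_isClosed hTc.isClosed (isClosed_Ici)
  have hPop : IsOpen P := by
    rw [isOpen_iff_mem_nhds]
    intro z hz
    have hzS : z ∈ Sᶜ := hTS hz.1
    have hzO : z ∈ O := by
      by_contra hzO
      have := hbd z hz.1.1 hzO hzS
      have := hz.2
      linarith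
    have hn : O ∩ Sᶜ ∈ 𝓝 z := (hO.inter hS.isOpen_compl).mem_nhds ⟨hzO, hzS⟩
    have hTmem : ∀ w ∈ O ∩ Sᶜ, m ≤ u w - k w → w ∈ T := fun w hw hmw =>
      ⟨hOQ hw.1, by have := hk0 w hw.2; linarith⟩
    have hlm : IsLocalMax (fun z => u z - k z) z := by
      filter_upwards [hn] with w hw
      by_contra hc
      push Not at hc
      have h2 := hz.2
      have : u w - k w ≤ u z1 - k z1 := hz1 (hTmem w hw (by linarith))
      linarith
    filter_upwards [hn, aux_localmax (hharm z ⟨hzO, hzS⟩) hlm] with w hw hw2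
    have h2 := hz.2
    exact ⟨hTmem w hw (by linarith), by linarith⟩
  rcases isClopen_iff.1 ⟨hPcl, hPop⟩ with h | h
  · have : z1 ∈ P := ⟨hz1T, le_rfl⟩
    rw [h] at this
    exact this
  · have hc : IsCompact P := hTc.of_isClosed_subset hPcl (fun z hz => hz.1)
    rw [h] at hc
    exact noncompact_univ ℂ hc

lemma aux_harnack {f : ℂ → ℝ} {c w : ℂ} {R : ℝ} (hf : HarmonicOnNhd f (closedBall c R))
    (hpos : ∀ z ∈ closedBall c R, 0 ≤ f z) (hw : w ∈ ball c R) :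
    (R - ‖w - c‖) * f w ≤ (R + ‖w - c‖) * f c ∧ (R - ‖w - c‖) * f c ≤ (R + ‖w - c‖) * f w := by
  have hR : 0 < R := pos_of_mem_ball hw
  have hwr : ‖w - c‖ < R := by simpa [dist_eq_norm] using hw
  have hn := norm_nonneg (w - c)
  have hp := hf.circleAverage_poissonKernel_smul hw
  have hm : Real.circleAverage f c R = f c :=
    InnerProductSpace.HarmonicOnNhd.circleAverage_eq (by rwa [abs_of_pos hR])
  have hfi : CircleIntegrable f c R :=
    ContinuousOn.circleIntegrable hR.le (hf.continuousOn.mono sphere_subset_closedBall)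
  have hpk : ∀ z ∈ sphere c R, ‖z - c - (w - c)‖ ≠ 0 := by
    intro z hz h0
    have : z - c = w - c := by rwa [norm_eq_zero, sub_eq_zero] at h0
    have hz' : ‖z - c‖ = R := by simpa [dist_eq_norm] using hz
    rw [this] at hz'
    linarith
  have hpi : CircleIntegrable (poissonKernel c w • f) c R := by
    apply ContinuousOn.circleIntegrable hR.le
    apply ContinuousOn.smul _ (hf.continuousOn.mono sphere_subset_closedBall)
    unfold poissonKernel
    apply ContinuousOn.div (by fun_prop) (by fun_prop)
    intro z hz
    exact pow_ne_zero 2 (hpk z hz)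
  have hsm : ∀ a : ℝ, Real.circleAverage (a • f) c R = a * f c := by
    intro a
    rw [Real.circleAverage_smul, hm, smul_eq_mul]
  constructor
  · have : f w ≤ ((R + ‖w - c‖) / (R - ‖w - c‖)) * f c := by
      rw [← hp, ← hsm]
      apply Real.circleAverage_mono hpi (hfi.const_smul)
      intro z hz
      rw [abs_of_pos hR] at hz
      have h1 := re_herglotzRieszKernel_le hz hw
      have h2 : poissonKernel c w z = (herglotzRieszKernel c w z).re := by
        rw [poissonKernel_eq_re_herglotzRieszKernel]; rfl
      have h3 := hpos z (sphere_subset_closedBall hz)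
      simp only [Pi.smul_apply', Pi.smul_apply, smul_eq_mul]
      rw [h2]
      exact mul_le_mul_of_nonneg_right h1 h3
    rw [div_mul_eq_mul_div, le_div_iff₀ (by linarith)] at this
    linarith
  · have : ((R - ‖w - c‖) / (R + ‖w - c‖)) * f c ≤ f w := by
      rw [← hp, ← hsm]
      apply Real.circleAverage_mono (hfi.const_smul) hpi
      intro z hz
      rw [abs_of_pos hR] at hz
      have h1 := le_re_herglotzRieszKernel hz hw
      have h2 : poissonKernel c w z = (herglotzRieszKernel c w z).re := by
        rw [poissonKernel_eq_re_herglotzRieszKernel]; rfl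
      have h3 := hpos z (sphere_subset_closedBall hz)
      simp only [Pi.smul_apply', Pi.smul_apply, smul_eq_mul]
      rw [h2]
      exact mul_le_mul_of_nonneg_right h1 h3
    rw [div_mul_eq_mul_div, div_le_iff₀ (by linarith)] at this
    linarith

lemma aux_vert {f : ℂ → ℝ} (hf : HarmonicOnNhd f {z | 0 < z.im})
    (hpos : ∀ z : ℂ, 0 < z.im → 0 < f z) {x y L : ℝ} (hy : 0 < y) (hyL : y ≤ L) :
    y * f ⟨x, y⟩ ≤ 4 * L * f ⟨x, L⟩ ∧ y * f ⟨x, L⟩ ≤ 4 * L * f ⟨x, y⟩ := by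
  have hsub : closedBall (⟨x, L⟩ : ℂ) (L - y / 2) ⊆ {z | 0 < z.im} := by
    intro z hz
    have h1 : ‖z - ⟨x, L⟩‖ ≤ L - y / 2 := by simpa [dist_eq_norm] using hz
    have h2 := (abs_le.1 (Complex.abs_im_le_norm (z - ⟨x, L⟩))).1
    simp at h2
    simp only [mem_ofPred_eq]
    linarith
  have hnorm : ‖(⟨x, y⟩ : ℂ) - ⟨x, L⟩‖ = L - y := by
    have : (⟨x, y⟩ : ℂ) - ⟨x, L⟩ = ((y - L : ℝ) : ℂ) * I := by
      apply Complex.ext <;> simp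
    rw [this, norm_mul, Complex.norm_I, mul_one, Complex.norm_real, Real.norm_eq_abs,
      abs_of_nonpos (by linarith)]
    ring
  have hb : (⟨x, y⟩ : ℂ) ∈ ball (⟨x, L⟩ : ℂ) (L - y / 2) := by
    rw [mem_ball, dist_eq_norm, hnorm]; linarith
  have := aux_harnack (hf.mono hsub) (fun z hz => (hpos z (hsub hz)).le) hb
  rw [hnorm] at this
  have p1 := hpos ⟨x, y⟩ hy
  have p2 := hpos ⟨x, L⟩ (lt_of_lt_of_le hy hyL)
  have q1 := mul_pos hy p1
  have q2 := mul_pos hy p2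
  constructor <;> nlinarith [this.1, this.2]

lemma aux_horiz {f : ℂ → ℝ} (hf : HarmonicOnNhd f {z | 0 < z.im})
    (hpos : ∀ z : ℂ, 0 < z.im → 0 < f z) {x x' L : ℝ} (hL : 0 < L) (hx : |x - x'| ≤ L / 2) :
    f ⟨x, L⟩ ≤ 5 * f ⟨x', L⟩ := by
  have hsub : closedBall (⟨x', L⟩ : ℂ) (3 * L / 4) ⊆ {z | 0 < z.im} := by
    intro z hz
    have h1 : ‖z - ⟨x', L⟩‖ ≤ 3 * L / 4 := by simpa [dist_eq_norm] using hz
    have h2 := (abs_le.1 (Complex.abs_im_le_norm (z - ⟨x', L⟩))).1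
    simp at h2
    simp only [mem_ofPred_eq]
    linarith
  have hnorm : ‖(⟨x, L⟩ : ℂ) - ⟨x', L⟩‖ = |x - x'| := by
    have : (⟨x, L⟩ : ℂ) - ⟨x', L⟩ = ((x - x' : ℝ) : ℂ) := by
      apply Complex.ext <;> simp
    rw [this, Complex.norm_real, Real.norm_eq_abs]
  have hb : (⟨x, L⟩ : ℂ) ∈ ball (⟨x', L⟩ : ℂ) (3 * L / 4) := by
    rw [mem_ball, dist_eq_norm, hnorm]; linarith
  have := aux_harnack (hf.mono hsub) (fun z hz => (hpos z (hsub hz)).le) hb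
  rw [hnorm] at this
  have p1 := hpos ⟨x, L⟩ hL
  have p2 := hpos ⟨x', L⟩ hL
  have h1 : (L / 4) * f ⟨x, L⟩ ≤ (5 * L / 4) * f ⟨x', L⟩ := by
    have t := this.1
    nlinarith
  have h2 : L * f ⟨x, L⟩ ≤ L * (5 * f ⟨x', L⟩) := by linarith
  exact le_of_mul_le_mul_left h2 hL

lemma aux_comb {f : ℂ → ℝ} (hf : HarmonicOnNhd f {z | 0 < z.im})
    (hpos : ∀ z : ℂ, 0 < z.im → 0 < f z) {x x0 y L : ℝ} (hy : 0 < y) (hyL : y ≤ L)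
    (hx : |x - x0| ≤ L / 2) :
    y * f ⟨x, y⟩ ≤ 20 * L * f ⟨x0, L⟩ ∧ y * f ⟨x0, L⟩ ≤ 20 * L * f ⟨x, y⟩ := by
  have hL : 0 < L := lt_of_lt_of_le hy hyL
  have hv := aux_vert hf hpos (x := x) hy hyL
  have h1 := aux_horiz hf hpos hL hx
  have h2 := aux_horiz hf hpos (x := x0) (x' := x) hL (by rwa [abs_sub_comm])
  constructor
  · nlinarith [hv.1]
  · nlinarith [hv.2]

noncomputable def vfun (x0 ρ : ℝ) (z : ℂ) : ℝ :=
  ((ρ : ℂ) / (ρ - (z - x0)) + (ρ : ℂ) / (ρ + (z - x0))).re - 2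

lemma vfun_eq (x0 ρ : ℝ) (z : ℂ) :
    vfun x0 ρ z = ρ * (ρ - (z.re - x0)) / ((ρ - (z.re - x0)) ^ 2 + z.im ^ 2) +
      ρ * (ρ + (z.re - x0)) / ((ρ + (z.re - x0)) ^ 2 + z.im ^ 2) - 2 := by
  simp [vfun, Complex.div_re, Complex.normSq_apply, pow_two]

lemma vfun_analytic {x0 ρ : ℝ} {z : ℂ} (hz : |z.re - x0| < ρ) :
    AnalyticAt ℂ (fun z : ℂ => (ρ : ℂ) / (ρ - (z - x0)) + (ρ : ℂ) / (ρ + (z - x0))) z := by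
  rw [abs_lt] at hz
  have h1 : (ρ : ℂ) - (z - x0) ≠ 0 := by
    intro h
    have := congrArg Complex.re h
    simp at this
    linarith
  have h2 : (ρ : ℂ) + (z - x0) ≠ 0 := by
    intro h
    have := congrArg Complex.re h
    simp at this
    linarith
  fun_prop (disch := assumption)

lemma vfun_harm {x0 ρ : ℝ} {z : ℂ} (hz : |z.re - x0| < ρ) : HarmonicAt (vfun x0 ρ) z :=
  (vfun_analytic hz).harmonicAt_re.sub (harmonicAt_const 2)

lemma vfun_lower {x0 ρ : ℝ} {z : ℂ} (hz : |z.re - x0| < ρ) (hy : |z.im| ≤ ρ - |z.re - x0|) :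
    ρ / (2 * (ρ - |z.re - x0|)) - 2 ≤ vfun x0 ρ z := by
  have hρ : 0 < ρ := lt_of_le_of_lt (abs_nonneg _) hz
  rw [vfun_eq]
  set X := z.re - x0 with hX
  have hXl := abs_lt.1 hz
  have hy2 : z.im ^ 2 ≤ (ρ - |X|) ^ 2 := by
    rw [← sq_abs z.im]
    exact pow_le_pow_left₀ (abs_nonneg _) hy 2
  have key : ∀ s : ℝ, 0 < s → z.im ^ 2 ≤ s ^ 2 → ρ / (2 * s) ≤ ρ * s / (s ^ 2 + z.im ^ 2) := by
    intro s hs h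
    rw [div_le_div_iff₀ (by positivity) (by positivity)]
    nlinarith
  have p1 : 0 ≤ ρ * (ρ - X) / ((ρ - X) ^ 2 + z.im ^ 2) :=
    div_nonneg (mul_nonneg hρ.le (by linarith)) (by positivity)
  have p2 : 0 ≤ ρ * (ρ + X) / ((ρ + X) ^ 2 + z.im ^ 2) :=
    div_nonneg (mul_nonneg hρ.le (by linarith)) (by positivity)
  rcases le_total 0 X with h | h
  · rw [abs_of_nonneg h] at *
    have := key (ρ - X) (by linarith) hy2
    linarith
  · rw [abs_of_nonpos h, sub_neg_eq_add] at *
    have := key (ρ + X) (by linarith) hy2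
    linarith

lemma aux_core {S : Set ℂ} (hS : IsClosed S) (hSr : ∀ z ∈ S, z.im = 0)
    {M h : ℂ → ℝ} (hMc : Continuous M) (hM0 : ∀ z ∈ S, M z = 0) (hMp : ∀ z ∈ Sᶜ, 0 < M z)
    (hMh : HarmonicOnNhd M Sᶜ) (hMs : ∀ z, M (starRingEnd ℂ z) = M z)
    (hp : ∀ z ∈ Sᶜ, 0 < h z) (hh : HarmonicOnNhd h Sᶜ)
    (hs : ∀ z ∈ Sᶜ, h (starRingEnd ℂ z) = h z)
    {x0 ρ : ℝ} (hρ : 0 < ρ) {z0 : ℂ} (hz0 : z0 ∈ Sᶜ) (hz0r : z0.re = x0) (hz0i : |z0.im| ≤ ρ / 2) :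
    h ⟨x0, 2 * ρ⟩ * M z0 ≤ 819200 * M ⟨x0, 2 * ρ⟩ * h z0 := by
  have hsub : {z : ℂ | 0 < z.im} ⊆ Sᶜ := by
    intro z hz hzS
    have := hSr z hzS
    simp only [mem_ofPred_eq] at hz
    linarith
  set m := M ⟨x0, 2 * ρ⟩ with hm
  set H := h ⟨x0, 2 * ρ⟩ with hH
  have htop : (⟨x0, 2 * ρ⟩ : ℂ) ∈ Sᶜ := hsub (show (0 : ℝ) < 2 * ρ by linarith)
  have hmp : 0 < m := hMp _ htop
  have hHp : 0 < H := hp _ htop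
  -- general Harnack on both sides of the real line
  have gen : ∀ f : ℂ → ℝ, HarmonicOnNhd f Sᶜ → (∀ z ∈ Sᶜ, 0 < f z) →
      (∀ z ∈ Sᶜ, f (starRingEnd ℂ z) = f z) → ∀ z : ℂ, z.im ≠ 0 → |z.im| ≤ ρ → |z.re - x0| ≤ ρ →
      |z.im| * f z ≤ 40 * ρ * f ⟨x0, 2 * ρ⟩ ∧ |z.im| * f ⟨x0, 2 * ρ⟩ ≤ 40 * ρ * f z := by
    intro f hf hfp hfs z hzi hzi2 hzr
    have hc := aux_comb (hf.mono hsub) (fun z hz => hfp z (hsub hz)) (x := z.re) (x0 := x0)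
      (y := |z.im|) (L := 2 * ρ) (abs_pos.2 hzi) (by linarith) (by linarith)
    have hfz : f ⟨z.re, |z.im|⟩ = f z := by
      rcases le_total 0 z.im with h | h
      · rw [abs_of_nonneg h]
      · rw [abs_of_nonpos h]
        rw [← hfs z (fun hzS => hzi (hSr z hzS))]
        congr 1
    rw [hfz] at hc
    constructor
    · linarith [hc.1]
    · linarith [hc.2]
  have gM := gen M hMh hMp (fun z _ => hMs z)
  have gh := gen h hh hp hs
  have hcompact : ∀ r : ℝ, IsCompact {z : ℂ | |z.re - x0| + |z.im| ≤ r} := by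
    intro r
    apply (isCompact_closedBall (⟨x0, 0⟩ : ℂ) r).of_isClosed_subset
    · apply isClosed_le
      · have := Complex.continuous_re
        have := Complex.continuous_im
        fun_prop
      · fun_prop
    · intro z hz
      rw [mem_closedBall, dist_eq_norm]
      have := Complex.norm_le_abs_re_add_abs_im (z - ⟨x0, 0⟩)
      simp at this
      exact this.trans hz
  obtain ⟨B0, hB0⟩ := (hcompact ρ).bddAbove_image hMc.continuousOn
  set B := max B0 1 with hB
  have hBpos : 0 < B := lt_of_lt_of_le one_pos (le_max_right _ _)
  have hMB : ∀ z : ℂ, |z.re - x0| + |z.im| ≤ ρ → M z ≤ B := fun z hz =>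
    (hB0 ⟨z, hz, rfl⟩).trans (le_max_left _ _)
  set δ := min (1 / 16) (40 * m / B) with hδ
  have hδ0 : 0 < δ := lt_min (by norm_num) (by positivity)
  have hδ1 : δ ≤ 1 / 16 := min_le_left _ _
  have hδ2 : B * δ ≤ 40 * m := by
    have : δ ≤ 40 * m / B := min_le_right _ _
    rw [le_div_iff₀ hBpos] at this
    linarith
  have hρδ : 0 < ρ * δ := mul_pos hρ hδ0
  have hρδ1 : ρ * δ ≤ ρ / 16 := by nlinarith
  set Q := {z : ℂ | |z.re - x0| + |z.im| ≤ ρ - ρ * δ} with hQ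
  set O := {z : ℂ | |z.re - x0| + |z.im| < ρ - ρ * δ} with hO
  have hQre : ∀ z ∈ Q, |z.re - x0| < ρ := by
    intro z hz
    have h1 : |z.re - x0| + |z.im| ≤ ρ - ρ * δ := hz
    have := abs_nonneg z.im
    linarith
  have hOQ : O ⊆ Q := by
    intro z hz
    have h1 : |z.re - x0| + |z.im| < ρ - ρ * δ := hz
    exact h1.le
  have hOo : IsOpen O := by
    apply isOpen_lt
    · have := Complex.continuous_re
      have := Complex.continuous_im
      fun_prop
    · fun_prop
  set K := 819200 * m / H with hK
  have hKp : 0 < K := by positivity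
  have hvh : ∀ z ∈ Q, HarmonicAt (vfun x0 ρ) z := fun z hz => vfun_harm (hQre z hz)
  have hmax := aux_maxp (Q := Q) (O := O) (S := S) (u := fun z => M z - 320 * m * vfun x0 ρ z)
    (k := fun z => K * h z) (hcompact _) hOo hOQ hS
    (hMc.continuousOn.sub (continuousOn_const.mul
      (HarmonicOnNhd.continuousOn (f := vfun x0 ρ) hvh)))
    (continuousOn_const.mul hh.continuousOn)
    (fun z hz => (mul_pos hKp (hp z hz)).le)
    (by
      intro z hz
      have e1 := hMh z hz.2
      have e2 := (hvh z (hOQ hz.1)).const_smul (c := 320 * m)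
      have e3 := (hh z hz.2).const_smul (c := K)
      exact (e1.sub e2).sub e3)
    (by
      rintro z ⟨hzQ, hzS⟩
      have h1 := hQre z hzQ
      have h2 := hSr z hzS
      simp only [hM0 z hzS]
      have : 0 ≤ vfun x0 ρ z := by
        rw [vfun_eq, h2]
        set X := z.re - x0 with hX
        have hXl := abs_lt.1 h1
        have a1 : 0 < ρ - X := by linarith
        have a2 : 0 < ρ + X := by linarith
        have : ρ * (ρ - X) / ((ρ - X) ^ 2 + 0 ^ 2) + ρ * (ρ + X) / ((ρ + X) ^ 2 + 0 ^ 2) - 2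
          = 2 * X ^ 2 / ((ρ - X) * (ρ + X)) := by
          field_simp
          ring
        rw [this]
        positivity
      have := mul_nonneg (by positivity : 0 ≤ 320 * m) this
      linarith)
    (by
      intro z hzQ hzO hzS
      have hk := mul_pos hKp (hp z hzS)
      have heq : |z.re - x0| + |z.im| = ρ - ρ * δ := le_antisymm hzQ (not_lt.1 hzO)
      have hre := hQre z hzQ
      have hv := vfun_lower hre (by linarith)
      set σ := ρ - |z.re - x0| with hσ
      have hσ0 : 0 < σ := by simp only [hσ]; linarith
      have hσe : σ = |z.im| + ρ * δ := by simp only [hσ]; linarith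
      have hi0 := abs_nonneg z.im
      have hr0 := abs_nonneg (z.re - x0)
      show M z - 320 * m * vfun x0 ρ z ≤ K * h z
      rcases le_or_gt σ (ρ / 8) with hc | hc
      · have hv4 : ρ / (4 * σ) ≤ vfun x0 ρ z := by
          have : 2 ≤ ρ / (4 * σ) := by
            rw [le_div_iff₀ (by positivity)]; linarith
          have e : ρ / (2 * σ) = 2 * (ρ / (4 * σ)) := by field_simp; ring
          linarith
        have hMv : M z ≤ 320 * m * (ρ / (4 * σ)) := by
          rw [← mul_div_assoc, le_div_iff₀ (by positivity)]
          have hMn : 0 < M z := hMp z hzS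
          rcases le_or_gt (ρ * δ) |z.im| with hd | hd
          · have hne : z.im ≠ 0 := abs_pos.1 (lt_of_lt_of_le hρδ hd)
            have := (gM z hne (by linarith) hre.le).1
            nlinarith
          · have hb := hMB z (by linarith)
            have : M z * (4 * σ) ≤ B * (8 * (ρ * δ)) :=
              mul_le_mul hb (by linarith) (by positivity) hBpos.le
            nlinarith
        have := mul_le_mul_of_nonneg_left hv4 (by positivity : 0 ≤ 320 * m)
        linarith
      · have hi : ρ / 16 ≤ |z.im| := by linarith
        have hne : z.im ≠ 0 := abs_pos.1 (by linarith)
        have g1 := (gM z hne (by linarith) hre.le).1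
        have g2 := (gh z hne (by linarith) hre.le).2
        have hMn : 0 < M z := hMp z hzS
        have b1 : M z ≤ 640 * m := by
          have : ρ * M z ≤ ρ * (640 * m) := by nlinarith
          exact le_of_mul_le_mul_left this hρ
        have b2 : H ≤ 640 * h z := by
          have : ρ * H ≤ ρ * (640 * h z) := by nlinarith
          exact le_of_mul_le_mul_left this hρ
        have b3 : -2 ≤ vfun x0 ρ z := by
          have : 0 ≤ ρ / (2 * σ) := by positivity
          linarith
        have b4 : 1280 * m ≤ K * h z := by
          rw [hK, div_mul_eq_mul_div, le_div_iff₀ hHp]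
          nlinarith
        nlinarith)
  have hz0O : z0 ∈ O := by
    show |z0.re - x0| + |z0.im| < ρ - ρ * δ
    rw [hz0r, sub_self, abs_zero]
    linarith
  have hfin := hmax z0 ⟨hz0O, hz0⟩
  have hv0 : vfun x0 ρ z0 ≤ 0 := by
    rw [vfun_eq, hz0r]
    have : ρ * (ρ - (x0 - x0)) / ((ρ - (x0 - x0)) ^ 2 + z0.im ^ 2) +
      ρ * (ρ + (x0 - x0)) / ((ρ + (x0 - x0)) ^ 2 + z0.im ^ 2) - 2
        = - (2 * z0.im ^ 2 / (ρ ^ 2 + z0.im ^ 2)) := by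
      simp only [sub_self, sub_zero, add_zero]
      field_simp
      ring
    rw [this]
    have : 0 ≤ 2 * z0.im ^ 2 / (ρ ^ 2 + z0.im ^ 2) := by positivity
    linarith
  have h5 : M z0 ≤ K * h z0 := by
    have : 0 ≤ 320 * m * (- vfun x0 ρ z0) := by
      apply mul_nonneg (by positivity); linarith
    linarith
  rw [hK, div_mul_eq_mul_div, le_div_iff₀ hHp] at h5
  linarith

end

theorem stmt10 (E : Set ℝ) (hEne : E.Nonempty) (hEcl : IsClosed E)
    (M : ℂ → ℝ) (hM_cont : Continuous M)
    (hM_zero : ∀ x ∈ E, M (x : ℂ) = 0)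
    (hM_pos : ∀ z ∈ (cplx E)ᶜ, 0 < M z)
    (hM_harm : HarmonicOn M (cplx E)ᶜ)
    (hM_symm : ∀ z : ℂ, M (starRingEnd ℂ z) = M z)
    (hM_growth : ∃ A : ℝ, ∀ z : ℂ, M z ≤ A * (1 + ‖z‖))
    (h : ℂ → ℝ)
    (hh_pos : ∀ z ∈ (cplx E)ᶜ, 0 < h z)
    (hh_harm : HarmonicOn h (cplx E)ᶜ)
    (hh_symm : ∀ z ∈ (cplx E)ᶜ, h (starRingEnd ℂ z) = h z)
    (hh_noeps : ¬ ∃ ε : ℝ, 0 < ε ∧ ∀ z ∈ (cplx E)ᶜ, ε * M z ≤ h z) :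
    Tendsto (fun y : ℝ => h ((y : ℂ) * Complex.I) / M ((y : ℂ) * Complex.I))
      atTop (nhds 0) := by
  have hSc : IsClosed (cplx E) :=
    Complex.isometry_ofReal.isClosedEmbedding.isClosedMap E hEcl
  have hSr : ∀ z ∈ cplx E, z.im = 0 := by
    rintro _ ⟨x, _, rfl⟩
    simp
  have hMh := aux_harm hSc.isOpen_compl hM_harm
  have hhh := aux_harm hSc.isOpen_compl hh_harm
  have hsub : {z : ℂ | 0 < z.im} ⊆ (cplx E)ᶜ := by
    intro z hz hzS
    have := hSr z hzS
    simp only [mem_ofPred_eq] at hz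
    linarith
  have hyI : ∀ y : ℝ, (y : ℂ) * Complex.I = ⟨0, y⟩ := by
    intro y
    apply Complex.ext <;> simp
  simp only [hyI]
  by_contra hcon
  apply hh_noeps
  have hex : ∃ d : ℝ, 0 < d ∧ ∀ N : ℝ, ∃ y : ℝ, N ≤ y ∧ 0 < y ∧ d * M ⟨0, y⟩ ≤ h ⟨0, y⟩ := by
    by_contra hne
    push Not at hne
    apply hcon
    rw [Metric.tendsto_atTop]
    intro e he
    obtain ⟨N, hN⟩ := hne e he
    refine ⟨max N 1, fun y hy => ?_⟩
    have hy0 : 0 < y := lt_of_lt_of_le one_pos ((le_max_right _ _).trans hy)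
    have hlt := hN y ((le_max_left _ _).trans hy) hy0
    have hm : 0 < M ⟨0, y⟩ := hM_pos _ (hsub hy0)
    have hp : 0 < h ⟨0, y⟩ := hh_pos _ (hsub hy0)
    rw [Real.dist_eq, sub_zero, abs_of_pos (div_pos hp hm), div_lt_iff₀ hm]
    exact hlt
  obtain ⟨d, hd, hdy⟩ := hex
  refine ⟨d / (25 * 819200), by positivity, fun z hz => ?_⟩
  obtain ⟨y, hy, hy0, hyd⟩ := hdy (2 * |z.re| + 4 * |z.im|)
  have hr0 := abs_nonneg z.re
  have hi0 := abs_nonneg z.im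
  have hcore := aux_core hSc hSr hM_cont (by rintro _ ⟨x, hx, rfl⟩; exact hM_zero x hx)
    hM_pos hMh hM_symm hh_pos hhh hh_symm (x0 := z.re) (ρ := y / 2) (by linarith) hz rfl
    (by linarith)
  rw [mul_div_cancel₀ y (two_ne_zero)] at hcore
  have k1 := aux_horiz (hMh.mono hsub) (fun z hz => hM_pos z (hsub hz)) (x := z.re) (x' := 0) hy0
    (by rw [sub_zero]; linarith)
  have k2 := aux_horiz (hhh.mono hsub) (fun z hz => hh_pos z (hsub hz)) (x := 0) (x' := z.re) hy0
    (by rw [zero_sub, abs_neg]; linarith)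
  have hH : 0 < h ⟨z.re, y⟩ := hh_pos _ (hsub hy0)
  have hz1 := hh_pos z hz
  have k3 : d * M ⟨z.re, y⟩ ≤ 25 * h ⟨z.re, y⟩ := by nlinarith
  have k4 : h ⟨z.re, y⟩ * (d * M z) ≤ h ⟨z.re, y⟩ * (25 * 819200 * h z) := by
    have a1 := mul_le_mul_of_nonneg_left hcore hd.le
    have a2 := mul_le_mul_of_nonneg_right k3 hz1.le
    linarith
  have k5 := le_of_mul_le_mul_left k4 hH
  rw [div_mul_eq_mul_div, div_le_iff₀ (by norm_num)]
  linarith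
end
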